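/- arXiv:2001.06470 — 2 statements merged into one kernel-verified Lean document; each statement's English description precedes it below -/
import Mathlib

section
/- Let A ∈ ℬ̃ with det(λI_n − A) = p_n(λ) − x_1 p_{n−1}(λ) − ⋯ − x_n p_0(λ), and let (0,1,…,n) = (b_1,…,e_1)⌢⋯⌢(b_s,…,e_s) be the concatenation associated to A, where e_1 < ⋯ < e_s are exactly the t ∈ {0,1,…,n} such that deg p_t(λ) = t. Then A is PB-companion if and only if the principal submatrix 𝔐_A[b_h,…,e_h] (rows and columns b_h,…,e_h of 𝔐_A) is nonsingular for every h = 1,…,s. -/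
open Polynomial Matrix

noncomputable section

/-- A square matrix is *unit lower Hessenberg* (ULH): every entry on the
superdiagonal equals `1` and every entry above the superdiagonal equals `0`. -/
def IsULH {R : Type*} [Zero R] [One R] {m : ℕ} (A : Matrix (Fin m) (Fin m) R) : Prop :=
  (∀ i j : Fin m, (j : ℕ) = (i : ℕ) + 1 → A i j = 1) ∧
  (∀ i j : Fin m, (i : ℕ) + 1 < (j : ℕ) → A i j = 0)

/-- The total order `≺` on positions: `(i,j) ≺ (i',j')` iff `i−j < i'−j'`, or
`i−j = i'−j'` and `i < i'`. -/
def Prec {m : ℕ} (a b : Fin m × Fin m) : Prop :=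
  ((a.1 : ℕ) - (a.2 : ℕ) < (b.1 : ℕ) - (b.2 : ℕ)) ∨
  ((a.1 : ℕ) - (a.2 : ℕ) = (b.1 : ℕ) - (b.2 : ℕ) ∧ (a.1 : ℕ) < (b.1 : ℕ))

/-- `pos` is a valid family of variable positions for a matrix of `ℋ`:
each position is on or below the main diagonal, and the positions are
strictly increasing in the order `≺`. -/
def IsHPos {m : ℕ} (pos : Fin m → Fin m × Fin m) : Prop :=
  (∀ k, ((pos k).2 : ℕ) ≤ ((pos k).1 : ℕ)) ∧
  (∀ k l : Fin m, k < l → Prec (pos k) (pos l))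

/-- `pos` is a valid family of variable positions for a matrix of `ℬ`:
in addition all variables lie in a common `t`-block, i.e.
`max j_k ≤ min i_k`. -/
def IsBPos {m : ℕ} (pos : Fin m → Fin m × Fin m) : Prop :=
  IsHPos pos ∧ ∀ k l : Fin m, ((pos k).2 : ℕ) ≤ ((pos l).1 : ℕ)

/-- The ULH matrix `H_{(i₁,j₁),…,(iₙ,jₙ)}` with `2n−1` nonzero entries: ones on the
superdiagonal and the variable `xₖ` at position `pos k` (0-indexed). -/
def HMat (F : Type*) [Field F] {n : ℕ} (pos : Fin n → Fin n × Fin n) :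
    Matrix (Fin n) (Fin n) (MvPolynomial (Fin n) F) :=
  fun i j => (if (j : ℕ) = (i : ℕ) + 1 then 1 else 0) +
    ∑ k : Fin n, if pos k = (i, j) then MvPolynomial.X k else 0

/-- The positions of the variables of `C_{i₁,…,iₙ}`: in 1-based terms `xₖ` lies at
`(iₖ, iₖ−k+1)`; here 0-indexed, given the row function `r`, the variable `x_{k+1}`
lies at `(r k, r k − k)`. -/
def CPos {n : ℕ} (r : Fin n → Fin n) (k : Fin n) : Fin n × Fin n :=
  (r k, ⟨(r k : ℕ) - (k : ℕ), lt_of_le_of_lt (Nat.sub_le _ _) (r k).isLt⟩)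

/-- The condition on the row indices defining the set `𝒞`: in 1-based terms
`k ≤ iₖ` and `iₖ−k+1 ≤ i₁ ≤ iₖ` for `k = 1,…,n`. -/
def IsCIdx {n : ℕ} (hn : 0 < n) (r : Fin n → Fin n) : Prop :=
  ∀ k : Fin n, (k : ℕ) ≤ (r k : ℕ) ∧
    (r k : ℕ) - (k : ℕ) ≤ (r ⟨0, hn⟩ : ℕ) ∧ (r ⟨0, hn⟩ : ℕ) ≤ (r k : ℕ)

/-- The matrix `C_{i₁,…,iₙ}`. -/
def CMat (F : Type*) [Field F] {n : ℕ} (r : Fin n → Fin n) :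
    Matrix (Fin n) (Fin n) (MvPolynomial (Fin n) F) :=
  HMat F (CPos r)

/-- The condition on the row indices defining the set `𝒢`: besides the `𝒞` conditions,
the rows of the variables are exactly `i₁,…,n` and their columns exactly `1,…,i₁`. -/
def IsGIdx {n : ℕ} (hn : 0 < n) (r : Fin n → Fin n) : Prop :=
  IsCIdx hn r ∧
  (∀ i : Fin n, (∃ k, r k = i) ↔ (r ⟨0, hn⟩ : ℕ) ≤ (i : ℕ)) ∧
  (∀ j : Fin n, (∃ k, (r k : ℕ) - (k : ℕ) = (j : ℕ)) ↔ (j : ℕ) ≤ (r ⟨0, hn⟩ : ℕ))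

/-- The condition on the row indices defining the set `ℱ` of Fiedler companion
matrices: besides the `𝒢` conditions, consecutive variables lie in the same row or
the same column, i.e. `i_{k+1} = i_k` or `i_{k+1} = i_k + 1`. -/
def IsFIdx {n : ℕ} (hn : 0 < n) (r : Fin n → Fin n) : Prop :=
  IsGIdx hn r ∧
  ∀ k l : Fin n, (l : ℕ) = (k : ℕ) + 1 → (r l = r k ∨ (r l : ℕ) = (r k : ℕ) + 1)

/-- `B` is a *ULH superpattern* of `A`: `B` is obtained from `A` by replacing some
(possibly none) zero entries of `A` lying below the superdiagonal by nonzero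
constants of `F`. -/
def IsULHSuperpatternOf {F : Type*} [Field F] {n : ℕ}
    (B A : Matrix (Fin n) (Fin n) (MvPolynomial (Fin n) F)) : Prop :=
  (∀ i j : Fin n, (i : ℕ) < (j : ℕ) → B i j = A i j) ∧
  (∀ i j : Fin n, (j : ℕ) ≤ (i : ℕ) →
    B i j = A i j ∨ (A i j = 0 ∧ ∃ c : F, c ≠ 0 ∧ B i j = MvPolynomial.C c))

/-- `A` is a *companion matrix*: `n` of its entries are the variables `x₁,…,xₙ`,
the remaining entries are constants of `F`, and
`det(λI − A) = λⁿ − x₁λ^{n−1} − ⋯ − xₙ`. -/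
def IsCompanion {F : Type*} [Field F] {n : ℕ}
    (A : Matrix (Fin n) (Fin n) (MvPolynomial (Fin n) F)) : Prop :=
  (∃ pos : Fin n → Fin n × Fin n, Function.Injective pos ∧
    (∀ k : Fin n, A (pos k).1 (pos k).2 = MvPolynomial.X k) ∧
    (∀ i j : Fin n, (∀ k, pos k ≠ (i, j)) → ∃ c : F, A i j = MvPolynomial.C c)) ∧
  A.charpoly = Polynomial.X ^ n -
    ∑ k : Fin n, Polynomial.C (MvPolynomial.X k) * Polynomial.X ^ (n - 1 - (k : ℕ))

/-- `A` is a *PB-companion matrix* (companion with respect to a polynomial basis):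
`n` of its entries are the variables `x₁,…,xₙ`, the remaining entries are constants
of `F`, and `det(λI − A) = pₙ(λ) − x₁p_{n−1}(λ) − ⋯ − xₙp₀(λ)` for some basis
`{pₙ,…,p₀}` of the space `F_n[λ]` of polynomials of degree at most `n`. -/
def IsPBCompanion {F : Type*} [Field F] {n : ℕ}
    (A : Matrix (Fin n) (Fin n) (MvPolynomial (Fin n) F)) : Prop :=
  (∃ pos : Fin n → Fin n × Fin n, Function.Injective pos ∧
    (∀ k : Fin n, A (pos k).1 (pos k).2 = MvPolynomial.X k) ∧
    (∀ i j : Fin n, (∀ k, pos k ≠ (i, j)) → ∃ c : F, A i j = MvPolynomial.C c)) ∧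
  ∃ p : Fin (n + 1) → Polynomial F,
    (∀ i, p i ∈ Polynomial.degreeLT F (n + 1)) ∧
    LinearIndependent F p ∧
    Submodule.span F (Set.range p) = Polynomial.degreeLT F (n + 1) ∧
    A.charpoly = (p ⟨n, n.lt_succ_self⟩).map (MvPolynomial.C : F →+* MvPolynomial (Fin n) F) -
      ∑ k : Fin n, Polynomial.C (MvPolynomial.X k) *
        (p ⟨n - 1 - (k : ℕ), by omega⟩).map (MvPolynomial.C : F →+* MvPolynomial (Fin n) F)

/-- The constant part of `A`: set `x₁ = ⋯ = xₙ = 0` in every entry. -/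
def constPart {F : Type*} [Field F] {n : ℕ}
    (A : Matrix (Fin n) (Fin n) (MvPolynomial (Fin n) F)) : Matrix (Fin n) (Fin n) F :=
  A.map (fun q => MvPolynomial.eval (fun _ => (0 : F)) q)

/-- The leading principal submatrix `A[1,…,m]` of order `m`. -/
def leadSub {R : Type*} {n : ℕ} (A : Matrix (Fin n) (Fin n) R) (m : ℕ) (h : m ≤ n) :
    Matrix (Fin m) (Fin m) R :=
  A.submatrix (Fin.castLE h) (Fin.castLE h)

/-- The trailing principal submatrix `A[n−m+1,…,n]` of order `m`. -/
def trailSub {R : Type*} {n : ℕ} (A : Matrix (Fin n) (Fin n) R) (m : ℕ) (h : m ≤ n) :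
    Matrix (Fin m) (Fin m) R :=
  A.submatrix (fun i => ⟨n - m + (i : ℕ), by omega⟩) (fun i => ⟨n - m + (i : ℕ), by omega⟩)

/-- A matrix whose entries are all constants of `F`. -/
def IsConstMatrix {F : Type*} [Field F] {n m : ℕ}
    (M : Matrix (Fin m) (Fin m) (MvPolynomial (Fin n) F)) : Prop :=
  ∀ i j, ∃ c : F, M i j = MvPolynomial.C c

/-- Membership in `𝔑^m_L(n₁,…,n_s)`: a constant ULH matrix of order `m` whose
leading principal submatrix of order `ns h` is nilpotent whenever `ns h ≠ 0`. -/
def MemNL {F : Type*} [Field F] {m : ℕ} (M : Matrix (Fin m) (Fin m) F)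
    {s : ℕ} (ns : Fin s → ℕ) (hns : ∀ h, ns h ≤ m) : Prop :=
  IsULH M ∧ ∀ h : Fin s, ns h ≠ 0 → IsNilpotent (leadSub M (ns h) (hns h))

/-- Membership in `𝔑^m_T(n₁,…,n_s)`: a constant ULH matrix of order `m` whose
trailing principal submatrix of order `ns h` is nilpotent whenever `ns h ≠ 0`. -/
def MemNT {F : Type*} [Field F] {m : ℕ} (M : Matrix (Fin m) (Fin m) F)
    {s : ℕ} (ns : Fin s → ℕ) (hns : ∀ h, ns h ≤ m) : Prop :=
  IsULH M ∧ ∀ h : Fin s, ns h ≠ 0 → IsNilpotent (trailSub M (ns h) (hns h))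

/-- `s_k(A)`: the sum of the entries of the `k`-subdiagonal of `A`. -/
def subdiagSum {F : Type*} [Field F] {n : ℕ}
    (A : Matrix (Fin n) (Fin n) (MvPolynomial (Fin n) F)) (k : ℕ) : MvPolynomial (Fin n) F :=
  ∑ i : Fin n, ∑ j : Fin n, if (i : ℕ) = (j : ℕ) + k then A i j else 0

/-- The upper shift matrix `Uₘ`: ones on the superdiagonal, zeros elsewhere. -/
def Ushift (R : Type*) [Zero R] [One R] (m : ℕ) : Matrix (Fin m) (Fin m) R :=
  fun i j => if (j : ℕ) = (i : ℕ) + 1 then 1 else 0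

/-- The backward identity matrix `Jₘ`: ones on the antidiagonal, zeros elsewhere. -/
def Jmat (R : Type*) [Zero R] [One R] (m : ℕ) : Matrix (Fin m) (Fin m) R :=
  fun i j => if (i : ℕ) + (j : ℕ) = m - 1 then 1 else 0

/-- The principal submatrix `M[b,…,e]` on rows and columns `b,…,e` (0-indexed). -/
def rangeSub {R : Type*} {m : ℕ} (M : Matrix (Fin m) (Fin m) R) (b e : ℕ) (h : e < m) :
    Matrix (Fin (e + 1 - b)) (Fin (e + 1 - b)) R :=
  M.submatrix (fun i => ⟨b + (i : ℕ), by omega⟩) (fun i => ⟨b + (i : ℕ), by omega⟩)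


section Hessenberg

variable {R : Type*} [CommRing R]

/-- If the rows of a Hessenberg matrix with superdiagonal entries `-1`, except the last one,
annihilate a vector with first entry `1`, then the last row applied to that vector is the
determinant. -/
theorem det_eq_mulVec_last {m : ℕ} (M : Matrix (Fin (m + 1)) (Fin (m + 1)) R)
    (hs : ∀ i : Fin m, M i.castSucc i.succ = -1)
    (hz : ∀ i j : Fin m, i < j → M i.castSucc j.succ = 0)
    (v : Fin (m + 1) → R) (hv0 : v 0 = 1) (hv : ∀ i : Fin m, (M *ᵥ v) i.castSucc = 0) :
    M.det = (M *ᵥ v) (Fin.last m) := by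
  have h1 : (M.updateCol 0 (M *ᵥ v)).det = M.det := by
    have h := Matrix.det_updateCol_sum M 0 v
    rw [hv0, one_smul] at h
    rw [← h]
    congr 2
    ext k
    simp [Matrix.mulVec, dotProduct, mul_comm]
  rw [← h1, Matrix.det_succ_column_zero, Fin.sum_univ_castSucc]
  have h2 : ((M.updateCol 0 (M *ᵥ v)).submatrix (Fin.last m).succAbove Fin.succ).det
      = (-1) ^ m := by
    rw [Matrix.det_of_isLowerTriangular]
    · simp [hs]
    · intro i j hij
      have : i < j := hij
      simp [hz i j this]
  rw [h2]
  simp [hv, mul_right_comm, ← mul_pow]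

/-- The leading principal minors of an infinite matrix. -/
def leadMinor (h : ℕ → ℕ → R) (m : ℕ) : R :=
  (Matrix.of fun i j : Fin m => h i j).det

theorem leadMinor_zero (h : ℕ → ℕ → R) : leadMinor h 0 = 1 := by
  simp [leadMinor]

theorem sum_mul_eq_zero_of_recurrence {h : ℕ → ℕ → R} {N i : ℕ} {D : ℕ → R} (hi : i + 1 < N)
    (hs : h i (i + 1) = -1) (hz : ∀ j, i + 1 < j → j < N → h i j = 0)
    (hD : D (i + 1) = ∑ j ∈ Finset.range (i + 1), h i j * D j) :
    ∑ j ∈ Finset.range N, h i j * D j = 0 := by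
  have hsub : ∑ j ∈ Finset.range (i + 2), h i j * D j = ∑ j ∈ Finset.range N, h i j * D j := by
    refine Finset.sum_subset (Finset.range_subset_range.2 hi) fun j hj hj' => ?_
    rw [Finset.mem_range] at hj hj'
    rw [hz j (by omega) hj, zero_mul]
  rw [← hsub, Finset.sum_range_succ, ← hD, hs]
  ring

theorem leadMinor_succ {h : ℕ → ℕ → R} {N : ℕ} (hs : ∀ i, i + 1 < N → h i (i + 1) = -1)
    (hz : ∀ i j, i + 1 < j → j < N → h i j = 0) {m : ℕ} (hm : m < N) :
    leadMinor h (m + 1) = ∑ j ∈ Finset.range (m + 1), h m j * leadMinor h j := by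
  induction m using Nat.strong_induction_on with
  | _ m ih =>
    have key (i : Fin (m + 1)) : ((Matrix.of fun i j : Fin (m + 1) => h i j) *ᵥ
        fun j => leadMinor h j) i = ∑ j ∈ Finset.range (m + 1), h i j * leadMinor h j := by
      rw [← Fin.sum_univ_eq_sum_range (fun j => h i j * leadMinor h j)]
      simp [Matrix.mulVec, dotProduct]
    have main := det_eq_mulVec_last (Matrix.of fun i j : Fin (m + 1) => h i j)
      (fun i => by simpa using hs i (by omega))
      (fun i j hij => by
        have : (i : ℕ) < j := hij
        simpa using hz i (j + 1) (by omega) (by omega))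
      (fun j => leadMinor h j) (by simp [leadMinor_zero])
      (fun i => by
        rw [key]
        exact sum_mul_eq_zero_of_recurrence (by simp) (hs _ (by simp; omega))
          (fun j h1 h2 => hz _ _ h1 (by omega)) (ih _ (by simp) (by simp; omega)))
    rw [leadMinor, main, key, Fin.val_last]

/-- The reflection of the leading `N × N` block of `h` in its antidiagonal. -/
def antiTranspose (N : ℕ) (h : ℕ → ℕ → R) (i j : ℕ) : R :=
  h (N - 1 - j) (N - 1 - i)

/-- The difference of the determinants of two Hessenberg matrices with superdiagonal entries `-1`,
in terms of the trailing principal minors of the first and the leading ones of the second. -/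
theorem leadMinor_sub_leadMinor {h g : ℕ → ℕ → R} {N : ℕ} (hN : 0 < N)
    (hs : ∀ i, i + 1 < N → h i (i + 1) = -1) (hz : ∀ i j, i + 1 < j → j < N → h i j = 0)
    (gs : ∀ i, i + 1 < N → g i (i + 1) = -1) (gz : ∀ i j, i + 1 < j → j < N → g i j = 0) :
    leadMinor h N - leadMinor g N = ∑ i ∈ Finset.range N, ∑ j ∈ Finset.range N,
      leadMinor (antiTranspose N h) (N - 1 - i) * (h i j - g i j) * leadMinor g j := by
  obtain ⟨n, rfl⟩ : ∃ n, N = n + 1 := ⟨N - 1, by omega⟩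
  set T := leadMinor (antiTranspose (n + 1) h) with hT
  have as : ∀ i, i + 1 < n + 1 → antiTranspose (n + 1) h i (i + 1) = -1 := fun i hi => by
    have := hs (n - (i + 1)) (by omega)
    rwa [show n - (i + 1) + 1 = n - i by omega] at this
  have az : ∀ i j, i + 1 < j → j < n + 1 → antiTranspose (n + 1) h i j = 0 := fun i j h1 h2 =>
    hz (n - j) (n - i) (by omega) (by omega)
  have row : ∀ i ∈ Finset.range (n + 1), ∑ j ∈ Finset.range (n + 1), g i j * leadMinor g j
      = if i = n then leadMinor g (n + 1) else 0 := fun i hi => by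
    rw [Finset.mem_range] at hi
    split_ifs with h1
    · rw [h1, leadMinor_succ gs gz (by omega)]
    · exact sum_mul_eq_zero_of_recurrence (by omega) (gs i (by omega)) (gz i)
        (leadMinor_succ gs gz hi)
  have col : ∀ j ∈ Finset.range (n + 1), ∑ i ∈ Finset.range (n + 1), T (n - i) * h i j
      = if j = 0 then T (n + 1) else 0 := fun j hj => by
    rw [Finset.mem_range] at hj
    rw [← Finset.sum_range_reflect]
    have e : ∑ i ∈ Finset.range (n + 1), T (n - (n + 1 - 1 - i)) * h (n + 1 - 1 - i) j
        = ∑ i ∈ Finset.range (n + 1), antiTranspose (n + 1) h (n - j) i * T i := by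
      refine Finset.sum_congr rfl fun i hi => ?_
      rw [Finset.mem_range] at hi
      rw [antiTranspose, mul_comm, show n + 1 - 1 - (n - j) = j by omega,
        show n - (n + 1 - 1 - i) = i by omega]
    rw [e]
    split_ifs with h1
    · rw [h1, Nat.sub_zero, hT, leadMinor_succ as az (by omega)]
    · exact sum_mul_eq_zero_of_recurrence (by omega) (as _ (by omega)) (az _)
        (leadMinor_succ as az (by omega))
  have full : T (n + 1) = leadMinor h (n + 1) := by
    rw [hT, leadMinor, leadMinor, ← Matrix.det_transpose,
      ← Matrix.det_submatrix_equiv_self Fin.revPerm]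
    congr 1
    ext i j
    simp only [antiTranspose, Matrix.submatrix_apply, Matrix.transpose_apply, Matrix.of_apply,
      Fin.revPerm_apply, Fin.val_rev]
    congr 1 <;> omega
  have e1 : ∑ i ∈ Finset.range (n + 1), ∑ j ∈ Finset.range (n + 1),
      T (n - i) * h i j * leadMinor g j = leadMinor h (n + 1) := by
    rw [Finset.sum_comm]
    simp_rw [← Finset.sum_mul]
    rw [Finset.sum_congr rfl fun j hj => by rw [col j hj]]
    simp [leadMinor_zero, full]
  have e2 : ∑ i ∈ Finset.range (n + 1), ∑ j ∈ Finset.range (n + 1),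
      T (n - i) * g i j * leadMinor g j = leadMinor g (n + 1) := by
    simp_rw [mul_assoc, ← Finset.mul_sum]
    rw [Finset.sum_congr rfl fun j hj => by rw [row j hj]]
    simp [hT, leadMinor_zero]
  rw [← e1, ← e2]
  simp only [mul_sub, sub_mul, Finset.sum_sub_distrib, Nat.add_sub_cancel]

theorem det_sub_det_of_hessenberg {n : ℕ} (M K : Matrix (Fin n) (Fin n) R)
    (hn : 0 < n)
    (hM : ∀ i j : Fin n, (j : ℕ) = i + 1 → M i j = -1)
    (hM' : ∀ i j : Fin n, (i : ℕ) + 1 < j → M i j = 0)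
    (hK : ∀ i j : Fin n, (j : ℕ) = i + 1 → K i j = -1)
    (hK' : ∀ i j : Fin n, (i : ℕ) + 1 < j → K i j = 0) :
    M.det - K.det = ∑ i : Fin n, ∑ j : Fin n,
      (trailSub M (n - 1 - i) (by omega)).det * (M i j - K i j) * (leadSub K j j.isLt.le).det := by
  let e (L : Matrix (Fin n) (Fin n) R) (i j : ℕ) : R :=
    if h : i < n ∧ j < n then L ⟨i, h.1⟩ ⟨j, h.2⟩ else 0
  have e_apply (L : Matrix (Fin n) (Fin n) R) {i j : ℕ} (hi : i < n) (hj : j < n) :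
      e L i j = L ⟨i, hi⟩ ⟨j, hj⟩ := dif_pos ⟨hi, hj⟩
  have e_sup (L : Matrix (Fin n) (Fin n) R) (hL : ∀ i j : Fin n, (j : ℕ) = i + 1 → L i j = -1)
      (i : ℕ) (hi : i + 1 < n) : e L i (i + 1) = -1 := by
    rw [e_apply L (by omega) hi]
    exact hL _ _ rfl
  have e_zero (L : Matrix (Fin n) (Fin n) R) (hL : ∀ i j : Fin n, (i : ℕ) + 1 < j → L i j = 0)
      (i j : ℕ) (hij : i + 1 < j) (hj : j < n) : e L i j = 0 := by
    rw [e_apply L (by omega) hj]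
    exact hL _ _ hij
  have lead (L : Matrix (Fin n) (Fin n) R) (m : ℕ) (hm : m ≤ n) :
      leadMinor (e L) m = (leadSub L m hm).det := by
    rw [leadMinor]
    congr 1
    ext i j
    exact e_apply L _ _
  have trail (L : Matrix (Fin n) (Fin n) R) (m : ℕ) (hm : m ≤ n) :
      leadMinor (antiTranspose n (e L)) m = (trailSub L m hm).det := by
    rw [leadMinor, ← Matrix.det_transpose, ← Matrix.det_submatrix_equiv_self Fin.revPerm]
    congr 1
    ext i j
    simp only [antiTranspose, Matrix.submatrix_apply, Matrix.transpose_apply, Matrix.of_apply,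
      Fin.revPerm_apply, Fin.val_rev, trailSub]
    rw [e_apply L (by omega) (by omega)]
    congr 2 <;> omega
  have main := leadMinor_sub_leadMinor hn (e_sup M hM) (e_zero M hM') (e_sup K hK) (e_zero K hK')
  rw [lead M n le_rfl, lead K n le_rfl] at main
  rw [show M.det = (leadSub M n le_rfl).det from rfl, show K.det = (leadSub K n le_rfl).det from rfl,
    main, Finset.sum_range]
  refine Finset.sum_congr rfl fun i _ => ?_
  rw [Finset.sum_range]
  refine Finset.sum_congr rfl fun j _ => ?_
  rw [trail M _ (by omega), lead K _ j.isLt.le, e_apply M i.isLt j.isLt, e_apply K i.isLt j.isLt]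

end Hessenberg

section Blocks

/-- A matrix over a field which is block lower triangular, the blocks ending at the indices
satisfying `E`, is nonsingular iff all its diagonal blocks are. -/
theorem det_ne_zero_iff_rangeSub {F : Type*} [Field F] {n : ℕ}
    (M : Matrix (Fin (n + 1)) (Fin (n + 1)) F) (E : ℕ → Prop) (hn : E n)
    (hM : ∀ i j : Fin (n + 1), ∀ e, E e → (i : ℕ) ≤ e → e < j → M i j = 0) :
    M.det ≠ 0 ↔ ∀ b e : ℕ, b ≤ e → (he : e ≤ n) → E e → (∀ t, b ≤ t → t < e → ¬ E t) →
      (b = 0 ∨ E (b - 1)) → (rangeSub M b e (by omega)).det ≠ 0 := by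
  classical
  have ex (i : Fin (n + 1)) : ∃ e, (i : ℕ) ≤ e ∧ E e := ⟨n, by omega, hn⟩
  set f : Fin (n + 1) → ℕ := fun i => Nat.find (ex i) with hf
  have f_le (i : Fin (n + 1)) : (i : ℕ) ≤ f i := (Nat.find_spec (ex i)).1
  have f_E (i : Fin (n + 1)) : E (f i) := (Nat.find_spec (ex i)).2
  have f_min (i : Fin (n + 1)) (e : ℕ) (h1 : (i : ℕ) ≤ e) (h2 : E e) : f i ≤ e :=
    Nat.find_min' _ ⟨h1, h2⟩
  have tri : Mᵀ.BlockTriangular f := fun i j hij =>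
    hM j i (f j) (f_E j) (f_le j) (by
      by_contra! h
      exact absurd (f_min i _ h (f_E j)) (by omega))
  have block (b e : ℕ) (hbe : b ≤ e) (he : e ≤ n) (hE : E e) (ht : ∀ t, b ≤ t → t < e → ¬ E t)
      (hb : b = 0 ∨ E (b - 1)) :
      (Mᵀ.toSquareBlock f e).det = (rangeSub M b e (by omega)).det := by
    have mem (i : Fin (n + 1)) : f i = e ↔ b ≤ i ∧ (i : ℕ) ≤ e := by
      constructor
      · intro h
        have h1 := f_le i
        refine ⟨?_, by omega⟩
        by_contra! h2
        rcases hb with hb | hb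
        · omega
        · have := f_min i (b - 1) (by omega) hb
          omega
      · rintro ⟨h1, h2⟩
        have h3 := f_le i
        have h4 := f_min i e h2 hE
        by_contra h5
        exact ht (f i) (by omega) (by omega) (f_E i)
    let eqv : Fin (e + 1 - b) ≃ {i : Fin (n + 1) // f i = e} :=
      { toFun := fun i => ⟨⟨b + i, by omega⟩, (mem _).2 ⟨by simp, by simp; omega⟩⟩
        invFun := fun i => ⟨i.1 - b, by have := (mem i.1).1 i.2; omega⟩
        left_inv := fun i => by ext; simp
        right_inv := fun i => by
          have := (mem i.1).1 i.2
          ext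
          simp
          omega }
    rw [← Matrix.det_submatrix_equiv_self eqv, ← Matrix.det_transpose]
    rfl
  rw [← Matrix.det_transpose, tri.det, Finset.prod_ne_zero_iff]
  constructor
  · intro h b e hbe he hE ht hb
    rw [← block b e hbe he hE ht hb]
    refine h e (Finset.mem_image.2 ⟨⟨e, by omega⟩, Finset.mem_univ _, ?_⟩)
    exact le_antisymm (f_min _ _ le_rfl hE) (f_le ⟨e, _⟩)
  · intro h a ha
    obtain ⟨i, -, rfl⟩ := Finset.mem_image.1 ha
    have he : f i ≤ n := f_min i n (by omega) hn
    have exb : ∃ b, b ≤ f i ∧ ∀ t, b ≤ t → t < f i → ¬ E t :=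
      ⟨f i, le_rfl, fun t h1 h2 => by omega⟩
    obtain ⟨h1, h2⟩ := Nat.find_spec exb
    have h3 : Nat.find exb = 0 ∨ E (Nat.find exb - 1) := by
      by_contra! h4
      refine Nat.find_min exb (m := Nat.find exb - 1) (by omega) ⟨by omega, fun t ht1 ht2 => ?_⟩
      rcases ht1.eq_or_lt with h5 | h5
      · exact h5 ▸ h4.2
      · exact h2 t (by omega) ht2
    rw [block _ _ h1 he (f_E i) h2 h3]
    exact h _ _ h1 he (f_E i) h2 h3

/-- Polynomials of degree at most `n` form a basis iff their coefficient matrix is nonsingular. -/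
theorem linearIndependent_iff_det_coeff_ne_zero {F : Type*} [Field F] {n : ℕ}
    (p : Fin n → Polynomial F) (hp : ∀ i, p i ∈ Polynomial.degreeLT F n) :
    LinearIndependent F p ↔ (Matrix.of fun i j : Fin n => (p i).coeff j).det ≠ 0 := by
  rw [← isUnit_iff_ne_zero, ← Matrix.isUnit_iff_isUnit_det,
    ← Matrix.linearIndependent_rows_iff_isUnit]
  let q : Fin n → Polynomial.degreeLT F n := fun i => ⟨p i, hp i⟩
  have h1 : LinearIndependent F p ↔ LinearIndependent F q :=
    LinearMap.linearIndependent_iff (Polynomial.degreeLT F n).subtype (v := q)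
      (Submodule.ker_subtype _)
  have h2 : LinearIndependent F (Polynomial.degreeLTEquiv F n ∘ q) ↔ LinearIndependent F q :=
    LinearMap.linearIndependent_iff (Polynomial.degreeLTEquiv F n).toLinearMap
      (LinearEquiv.ker _)
  rw [h1, ← h2]
  rfl

theorem span_eq_degreeLT_of_linearIndependent {F : Type*} [Field F] {n : ℕ}
    {p : Fin n → Polynomial F} (hp : ∀ i, p i ∈ Polynomial.degreeLT F n)
    (hli : LinearIndependent F p) :
    Submodule.span F (Set.range p) = Polynomial.degreeLT F n := by
  have : Module.Finite F (Polynomial.degreeLT F n) :=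
    Module.Finite.equiv (Polynomial.degreeLTEquiv F n).symm
  refine Submodule.eq_of_le_of_finrank_eq
    (Submodule.span_le.2 (Set.range_subset_iff.2 hp)) ?_
  rw [finrank_span_eq_card hli, (Polynomial.degreeLTEquiv F n).finrank_eq]
  simp

end Blocks

section Superpattern

variable {F : Type*} [Field F] {n : ℕ}

theorem IsBPos.injective {pos : Fin n → Fin n × Fin n} (hpos : IsBPos pos) :
    Function.Injective pos := by
  intro k l hkl
  by_contra hne
  rcases lt_or_gt_of_ne hne with h | h
  · have := hpos.1.2 _ _ h
    simp [Prec, hkl] at this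
  · have := hpos.1.2 _ _ h
    simp [Prec, hkl] at this

theorem HMat_apply_pos {pos : Fin n → Fin n × Fin n} (hpos : IsBPos pos) (k : Fin n) :
    HMat F pos (pos k).1 (pos k).2 = MvPolynomial.X k := by
  have h := hpos.1.1 k
  rw [HMat, if_neg (by omega), zero_add, Finset.sum_eq_single k]
  · simp
  · intro l _ hl
    exact if_neg fun h => hl (hpos.injective h)
  · simp

theorem HMat_apply_of_ne {pos : Fin n → Fin n × Fin n} {i j : Fin n} (h : ∀ k, pos k ≠ (i, j)) :
    HMat F pos i j = if (j : ℕ) = i + 1 then 1 else 0 := by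
  simp [HMat, h]

variable {pos : Fin n → Fin n × Fin n} {A : Matrix (Fin n) (Fin n) (MvPolynomial (Fin n) F)}

theorem apply_pos_of_isULHSuperpatternOf (hpos : IsBPos pos)
    (hA : IsULHSuperpatternOf A (HMat F pos)) (k : Fin n) :
    A (pos k).1 (pos k).2 = MvPolynomial.X k := by
  rcases hA.2 _ _ (hpos.1.1 k) with h | ⟨h, -⟩
  · rw [h, HMat_apply_pos hpos]
  · rw [HMat_apply_pos hpos] at h
    exact absurd h (MvPolynomial.X_ne_zero k)

theorem apply_of_lt_of_isULHSuperpatternOf (hpos : IsBPos pos)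
    (hA : IsULHSuperpatternOf A (HMat F pos)) {i j : Fin n} (hij : (i : ℕ) < j) :
    A i j = if (j : ℕ) = i + 1 then 1 else 0 := by
  rw [hA.1 i j hij, HMat_apply_of_ne]
  intro k hk
  have := hpos.1.1 k
  rw [hk] at this
  exact absurd this (not_le.2 hij)

theorem apply_of_ne_of_isULHSuperpatternOf (hA : IsULHSuperpatternOf A (HMat F pos)) {i j : Fin n}
    (h : ∀ k, pos k ≠ (i, j)) : A i j = MvPolynomial.C (constPart A i j) := by
  suffices h : ∃ c : F, A i j = MvPolynomial.C c by
    obtain ⟨c, hc⟩ := h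
    simp [constPart, hc]
  have hH : ∃ c : F, HMat F pos i j = MvPolynomial.C c := by
    rw [HMat_apply_of_ne h]
    split_ifs
    · exact ⟨1, by simp⟩
    · exact ⟨0, by simp⟩
  rcases lt_or_ge (i : ℕ) j with h1 | h1
  · rw [hA.1 i j h1]
    exact hH
  · rcases hA.2 i j h1 with h2 | ⟨-, c, -, h2⟩
    · rw [h2]
      exact hH
    · exact ⟨c, h2⟩

/-- The characteristic polynomial of a superpattern is affine in the variables. -/
theorem charpoly_of_isULHSuperpatternOf (hn : 0 < n) (hpos : IsBPos pos)
    (hA : IsULHSuperpatternOf A (HMat F pos)) :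
    A.charpoly = (constPart A).charpoly.map (MvPolynomial.C : F →+* MvPolynomial (Fin n) F) -
      ∑ k : Fin n, Polynomial.C (MvPolynomial.X k) *
        ((leadSub (constPart A) ((pos k).2 : ℕ) ((pos k).2).isLt.le).charpoly *
        (trailSub (constPart A) (n - 1 - ((pos k).1 : ℕ))
          ((Nat.sub_le _ _).trans (Nat.sub_le _ _))).charpoly).map
          (MvPolynomial.C : F →+* MvPolynomial (Fin n) F) := by
  set φ : F →+* MvPolynomial (Fin n) F := MvPolynomial.C
  set K : Matrix (Fin n) (Fin n) (MvPolynomial (Fin n) F) := (constPart A).map φ with hK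
  have K_apply (i j : Fin n) (h : ∀ k, pos k ≠ (i, j)) : A i j = K i j :=
    apply_of_ne_of_isULHSuperpatternOf hA h
  have K_pos (k : Fin n) : K (pos k).1 (pos k).2 = 0 := by
    simp [hK, constPart, apply_pos_of_isULHSuperpatternOf hpos hA]
  have not_pos {i j : Fin n} (hij : (i : ℕ) < j) (k : Fin n) : pos k ≠ (i, j) := by
    intro hk
    have := hpos.1.1 k
    rw [hk] at this
    exact absurd this (not_le.2 hij)
  have hA1 (i j : Fin n) (h : (j : ℕ) = i + 1) : A i j = 1 := by
    rw [apply_of_lt_of_isULHSuperpatternOf hpos hA (by omega), if_pos h]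
  have hA0 (i j : Fin n) (h : (i : ℕ) + 1 < j) : A i j = 0 := by
    rw [apply_of_lt_of_isULHSuperpatternOf hpos hA (by omega), if_neg (by omega)]
  have key := det_sub_det_of_hessenberg A.charmatrix K.charmatrix hn
    (fun i j h => by
      rw [charmatrix_apply_ne _ _ _ (Fin.ne_of_val_ne (by omega)), hA1 i j h, map_one])
    (fun i j h => by
      rw [charmatrix_apply_ne _ _ _ (Fin.ne_of_val_ne (by omega)), hA0 i j h, map_zero, neg_zero])
    (fun i j h => by
      rw [charmatrix_apply_ne _ _ _ (Fin.ne_of_val_ne (by omega)),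
        ← K_apply i j (not_pos (by omega)), hA1 i j h, map_one])
    (fun i j h => by
      rw [charmatrix_apply_ne _ _ _ (Fin.ne_of_val_ne (by omega)),
        ← K_apply i j (not_pos (by omega)), hA0 i j h, map_zero, neg_zero])
  have diff (i j : Fin n) :
      A.charmatrix i j - K.charmatrix i j = -Polynomial.C (A i j - K i j) := by
    simp only [charmatrix_apply, map_sub]
    ring
  have lead (m : ℕ) (hm : m ≤ n) :
      (leadSub K.charmatrix m hm).det = (leadSub (constPart A) m hm).charpoly.map φ := by
    rw [← Matrix.charpoly_map, Matrix.charpoly]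
    congr 1
    ext1 i j
    simp [leadSub, charmatrix_apply, Matrix.diagonal_apply, hK]
  have trail (k : Fin n) :
      (trailSub A.charmatrix (n - 1 - (pos k).1) ((Nat.sub_le _ _).trans (Nat.sub_le _ _))).det =
      (trailSub (constPart A) (n - 1 - (pos k).1)
        ((Nat.sub_le _ _).trans (Nat.sub_le _ _))).charpoly.map φ := by
    rw [← Matrix.charpoly_map, Matrix.charpoly]
    congr 1
    ext1 i j
    have := K_apply ⟨n - (n - 1 - (pos k).1) + i, by omega⟩ ⟨n - (n - 1 - (pos k).1) + j, by omega⟩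
      (fun l hl => by
        have := hpos.2 l k
        rw [hl] at this
        simp only at this
        omega)
    simp [trailSub, charmatrix_apply, Matrix.diagonal_apply, this, hK, Fin.ext_iff]
  have hdet : K.charmatrix.det = (constPart A).charpoly.map φ := by
    rw [← Matrix.charpoly_map]
    rfl
  rw [hdet, ← Fintype.sum_prod_type' (fun i j : Fin n =>
    (trailSub A.charmatrix (n - 1 - i) (by omega)).det *
      (A.charmatrix i j - K.charmatrix i j) * (leadSub K.charmatrix j j.isLt.le).det)] at key
  rw [Matrix.charpoly, sub_eq_add_neg, ← sub_eq_iff_eq_add', key, ← Finset.sum_neg_distrib]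
  symm
  refine Finset.sum_of_injOn pos hpos.injective.injOn (by simp) (fun x _ hx => ?_) (fun k _ => ?_)
  · rw [diff, K_apply x.1 x.2 fun k hk => hx ⟨k, by simp, hk⟩]
    simp
  · rw [diff, K_pos, apply_pos_of_isULHSuperpatternOf hpos hA, lead, trail, Polynomial.map_mul,
      sub_zero]
    ring

end Superpattern

/-- The polynomials in `p_n - x_1 p_{n-1} - ⋯ - x_n p_0` are determined by the sum. -/
theorem eq_of_map_sub_sum_eq {F : Type*} [Field F] {n : ℕ} {p q : Fin (n + 1) → Polynomial F}
    (h : (p ⟨n, n.lt_succ_self⟩).map (MvPolynomial.C : F →+* MvPolynomial (Fin n) F) -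
      ∑ k : Fin n, Polynomial.C (MvPolynomial.X k) *
        (p ⟨n - 1 - (k : ℕ), by omega⟩).map (MvPolynomial.C : F →+* MvPolynomial (Fin n) F) =
      (q ⟨n, n.lt_succ_self⟩).map (MvPolynomial.C : F →+* MvPolynomial (Fin n) F) -
      ∑ k : Fin n, Polynomial.C (MvPolynomial.X k) *
        (q ⟨n - 1 - (k : ℕ), by omega⟩).map (MvPolynomial.C : F →+* MvPolynomial (Fin n) F)) :
    p = q := by
  have ev (x : Fin n → F) : p ⟨n, n.lt_succ_self⟩ - ∑ k : Fin n, Polynomial.C (x k) *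
      p ⟨n - 1 - (k : ℕ), by omega⟩ = q ⟨n, n.lt_succ_self⟩ - ∑ k : Fin n, Polynomial.C (x k) *
      q ⟨n - 1 - (k : ℕ), by omega⟩ := by
    have hx : (MvPolynomial.eval x).comp MvPolynomial.C = RingHom.id F := by ext; simp
    have := congrArg (Polynomial.map (MvPolynomial.eval x)) h
    simpa [Polynomial.map_sum, Polynomial.map_map, hx] using this
  have h0 : p ⟨n, n.lt_succ_self⟩ = q ⟨n, n.lt_succ_self⟩ := by simpa using ev 0
  have h1 (k : Fin n) : p ⟨n - 1 - (k : ℕ), by omega⟩ = q ⟨n - 1 - (k : ℕ), by omega⟩ := by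
    have := ev (Pi.single k 1)
    simpa [h0, Pi.single_apply, apply_ite Polynomial.C, ite_mul] using this
  ext1 t
  rcases (Nat.le_of_lt_succ t.isLt).eq_or_lt with ht | ht
  · rwa [show t = ⟨n, n.lt_succ_self⟩ from Fin.ext ht]
  · have h2 := h1 ⟨n - 1 - t, by omega⟩
    rwa [show (⟨n - 1 - (n - 1 - (t : ℕ)), by omega⟩ : Fin (n + 1)) = t by ext; simp; omega] at h2

/-- A matrix `A ∈ ℬ̃` is PB-companion iff for every component
`(b,…,e)` of the concatenation associated to `A` (where the endpoints `e` are
exactly the `t ∈ {0,…,n}` with `deg pₜ = t`), the principal submatrix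
`𝔐_A[b,…,e]` is nonsingular. -/
theorem pbCompanion_iff_blocks_nonsingular {F : Type*} [Field F] {n : ℕ} (hn : 0 < n)
    (pos : Fin n → Fin n × Fin n) (hpos : IsBPos pos)
    (A : Matrix (Fin n) (Fin n) (MvPolynomial (Fin n) F))
    (hA : IsULHSuperpatternOf A (HMat F pos))
    (p : Fin (n + 1) → Polynomial F)
    (hpn : p ⟨n, n.lt_succ_self⟩ = (constPart A).charpoly)
    (hpk : ∀ k : Fin n, p ⟨n - 1 - (k : ℕ), by omega⟩ =
      (leadSub (constPart A) ((pos k).2 : ℕ) ((pos k).2).isLt.le).charpoly *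
      (trailSub (constPart A) (n - 1 - ((pos k).1 : ℕ)) (by omega)).charpoly)
    (MA : Matrix (Fin (n + 1)) (Fin (n + 1)) F)
    (hMA : ∀ i j : Fin (n + 1), MA i j = (p i).coeff (j : ℕ)) :
    IsPBCompanion A ↔
      ∀ b e : ℕ, (hbe : b ≤ e) → (he : e ≤ n) →
        (p ⟨e, by omega⟩).degree = (e : WithBot ℕ) →
        (∀ t : ℕ, (ht1 : b ≤ t) → (ht2 : t < e) → (p ⟨t, by omega⟩).degree ≠ (t : WithBot ℕ)) →
        (b = 0 ∨ (p ⟨b - 1, by omega⟩).degree = ((b - 1 : ℕ) : WithBot ℕ)) →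
        (rangeSub MA b e (by omega)).det ≠ 0 := by
  have hchar : A.charpoly =
      (p ⟨n, n.lt_succ_self⟩).map (MvPolynomial.C : F →+* MvPolynomial (Fin n) F) -
      ∑ k : Fin n, Polynomial.C (MvPolynomial.X k) *
        (p ⟨n - 1 - (k : ℕ), by omega⟩).map (MvPolynomial.C : F →+* MvPolynomial (Fin n) F) := by
    simp_rw [hpk, hpn]
    exact charpoly_of_isULHSuperpatternOf hn hpos hA
  have eq_sub (t : ℕ) (ht : t < n) : (⟨t, by omega⟩ : Fin (n + 1)) =
      ⟨n - 1 - ((⟨n - 1 - t, by omega⟩ : Fin n) : ℕ), by omega⟩ := by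
    ext
    simp only
    omega
  have deg_pos (k : Fin n) : (p ⟨n - 1 - (k : ℕ), by omega⟩).natDegree =
      n - 1 - ((pos k).1 - (pos k).2) := by
    rw [hpk, (Matrix.charpoly_monic _).natDegree_mul (Matrix.charpoly_monic _),
      Matrix.charpoly_natDegree_eq_dim, Matrix.charpoly_natDegree_eq_dim, Fintype.card_fin,
      Fintype.card_fin]
    have := hpos.1.1 k
    omega
  have deg_n : (p ⟨n, n.lt_succ_self⟩).natDegree = n := by
    rw [hpn, Matrix.charpoly_natDegree_eq_dim, Fintype.card_fin]
  have deg_lt (t : ℕ) (ht : t < n) : (p ⟨t, by omega⟩).natDegree < n := by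
    rw [eq_sub t ht, deg_pos]
    omega
  have deg_mono (s t : ℕ) (hst : s ≤ t) (ht : t ≤ n) :
      (p ⟨s, by omega⟩).natDegree ≤ (p ⟨t, by omega⟩).natDegree := by
    rcases hst.eq_or_lt with rfl | hst
    · rfl
    rcases ht.eq_or_lt with rfl | ht
    · rw [deg_n]
      exact (deg_lt s hst).le
    rw [eq_sub s (by omega), eq_sub t ht, deg_pos, deg_pos]
    have := hpos.1.2 ⟨n - 1 - t, by omega⟩ ⟨n - 1 - s, by omega⟩ (Fin.mk_lt_mk.2 (by omega))
    unfold Prec at this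
    omega
  have mem (i : Fin (n + 1)) : p i ∈ Polynomial.degreeLT F (n + 1) := by
    rw [Polynomial.mem_degreeLT]
    refine lt_of_le_of_lt Polynomial.degree_le_natDegree ?_
    have := deg_mono i n (by omega) le_rfl
    rw [deg_n] at this
    exact_mod_cast Nat.lt_succ_of_le this
  have hMA' : MA = Matrix.of fun i j : Fin (n + 1) => (p i).coeff j := by
    ext i j
    exact hMA i j
  have hcomp : IsPBCompanion A ↔ MA.det ≠ 0 := by
    rw [hMA', ← linearIndependent_iff_det_coeff_ne_zero p mem]
    constructor
    · rintro ⟨-, q, -, hq, -, hqA⟩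
      rwa [eq_of_map_sub_sum_eq (hchar.symm.trans hqA)]
    · intro hli
      exact ⟨⟨pos, hpos.injective, apply_pos_of_isULHSuperpatternOf hpos hA,
        fun i j h => ⟨_, apply_of_ne_of_isULHSuperpatternOf hA h⟩⟩,
        p, mem, hli, span_eq_degreeLT_of_linearIndependent mem hli, hchar⟩
  let E (t : ℕ) : Prop := ∃ h : t ≤ n, (p ⟨t, by omega⟩).degree = (t : WithBot ℕ)
  have hE : E n := by
    refine ⟨le_rfl, ?_⟩
    rw [hpn, Matrix.charpoly_degree_eq_dim, Fintype.card_fin]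
  have tri (i j : Fin (n + 1)) (e : ℕ) (he : E e) (hi : (i : ℕ) ≤ e) (hj : e < j) :
      MA i j = 0 := by
    obtain ⟨hen, he⟩ := he
    rw [hMA]
    refine Polynomial.coeff_eq_zero_of_natDegree_lt (lt_of_le_of_lt (deg_mono i e hi hen) ?_)
    rwa [Polynomial.natDegree_eq_of_degree_eq_some he]
  rw [hcomp, det_ne_zero_iff_rangeSub MA E hE tri]
  refine forall_congr' fun b => forall_congr' fun e => forall_congr' fun hbe =>
    forall_congr' fun he => ?_
  constructor
  · intro h h1 h2 h3
    exact h ⟨he, h1⟩ (fun t ht1 ht2 ht => h2 t ht1 ht2 ht.2)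
      (h3.imp id fun h => ⟨by omega, h⟩)
  · intro h h1 h2 h3
    exact h h1.2 (fun t ht1 ht2 ht => h2 t ht1 ht2 ⟨by omega, ht⟩) (h3.imp id fun h => h.2)
end
end

section
/- Let A ∈ ℬ̃ with det(λI_n − A) = p_n(λ) − x_1 p_{n−1}(λ) − ⋯ − x_n p_0(λ). Then A is a PB-companion matrix such that every component of the concatenation associated to A has length one or two if and only if for every k = 0,1,…,n−1 the k-subdiagonal of A satisfies one of the following: (I) the only variable on it is x_{k+1}; (II) the only variables on it are x_{k+1} and x_{k+2}, located at entries (i, i−k) and (i′, i′−k) respectively, and Σ_{r=i−k}^{i} a_{rr} ≠ Σ_{r=i′−k}^{i′} a_{rr}, where a_{rr} are the diagonal entries of A; or (III) no variable appears on it. -/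
open Polynomial Matrix

noncomputable section

/-- The order-`m` leading determinant of an `ℕ`-indexed array. -/
def hdet {R : Type*} [CommRing R] (a : ℕ → ℕ → R) (m : ℕ) : R :=
  (Matrix.of fun i j : Fin m => a i j).det

/-- The leading `n × n` block of `a` is lower Hessenberg with superdiagonal `-1`. -/
def IsNegHess {R : Type*} [CommRing R] (n : ℕ) (a : ℕ → ℕ → R) : Prop :=
  (∀ i, i + 1 < n → a i (i + 1) = -1) ∧ ∀ i j, j < n → i + 1 < j → a i j = 0

section Hessenberg

variable {R : Type*} [CommRing R]

lemma hdet_zero (a : ℕ → ℕ → R) : hdet a 0 = 1 := by simp [hdet]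

lemma hdet_congr {a b : ℕ → ℕ → R} {m : ℕ} (h : ∀ i < m, ∀ j < m, a i j = b i j) :
    hdet a m = hdet b m := by
  unfold hdet
  congr 1
  ext i j
  exact h i i.2 j j.2

lemma IsNegHess.sum_eq {n : ℕ} {a : ℕ → ℕ → R} (ha : IsNegHess n a) (u : ℕ → R) {i m : ℕ}
    (hi : i + 1 < m) (hm : m ≤ n) :
    ∑ j ∈ Finset.range m, a i j * u j =
      ∑ j ∈ Finset.range (i + 1), a i j * u j - u (i + 1) := by
  have hsub : Finset.range (i + 2) ⊆ Finset.range m := by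
    intro x hx
    simp only [Finset.mem_range] at *
    omega
  rw [← Finset.sum_subset hsub, Finset.sum_range_succ, ha.1 i (by omega)]
  · ring
  · intro x hx hx'
    simp only [Finset.mem_range] at *
    rw [ha.2 i x (by omega) (by omega), zero_mul]

lemma IsNegHess.hdet_succ {n : ℕ} {a : ℕ → ℕ → R} (ha : IsNegHess n a) (m : ℕ) (hm : m < n) :
    hdet a (m + 1) = ∑ j ∈ Finset.range (m + 1), a m j * hdet a j := by
  induction m using Nat.strong_induction_on with
  | _ m ih =>
    set M : Matrix (Fin (m + 1)) (Fin (m + 1)) R := Matrix.of fun i j => a i j with hM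
    set S := ∑ j ∈ Finset.range (m + 1), a m j * hdet a j with hS
    have hMu : M *ᵥ (fun j => hdet a j) = Pi.single (Fin.last m) S := by
      ext i
      have h1 : (M *ᵥ (fun j => hdet a j)) i = ∑ j ∈ Finset.range (m + 1), a i j * hdet a j := by
        rw [Finset.sum_range]
        rfl
      rw [h1]
      by_cases hi : i = Fin.last m
      · subst hi
        simp [hS]
      · have hlt : (i : ℕ) < m := Fin.val_lt_last hi
        rw [Pi.single_eq_of_ne hi, ha.sum_eq _ (by omega) (by omega), ih i hlt (by omega), sub_self]
    have hadj : M.adjugate 0 (Fin.last m) = 1 := by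
      rw [Matrix.adjugate_fin_succ_eq_det_submatrix, Matrix.det_of_isLowerTriangular]
      · have : ∀ i : Fin m, M.submatrix (Fin.last m).succAbove (Fin.succAbove 0) i i = -1 := by
          intro i
          simp only [hM, Matrix.submatrix_apply, Matrix.of_apply, Fin.succAbove_last,
            Fin.succAbove_zero, Fin.val_castSucc, Fin.val_succ]
          exact ha.1 i (by omega)
        simp only [this, Finset.prod_const, Finset.card_univ, Fintype.card_fin]
        simp [← mul_pow]
      · intro i j hij
        simp only [hM, Matrix.submatrix_apply, Matrix.of_apply, Fin.succAbove_last,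
            Fin.succAbove_zero, Fin.val_castSucc, Fin.val_succ]
        have : (i : ℕ) < j := by simpa using hij
        exact ha.2 i _ (by omega) (by omega)
    have key : (M.adjugate *ᵥ (M *ᵥ (fun j => hdet a j))) 0 = M.det := by
      rw [Matrix.mulVec_mulVec, Matrix.adjugate_mul, Matrix.smul_mulVec, Matrix.one_mulVec]
      simp [hdet_zero]
    rw [hMu] at key
    simp only [Matrix.mulVec_single, Pi.smul_apply, Matrix.col_apply, hadj] at key
    simpa [hdet] using key.symm

lemma IsNegHess.sum_mul_hdet {n : ℕ} {a : ℕ → ℕ → R} (ha : IsNegHess n a) {i : ℕ} (hi : i < n) :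
    ∑ j ∈ Finset.range n, a i j * hdet a j = if i + 1 = n then hdet a n else 0 := by
  split_ifs with h
  · subst h
    rw [ha.hdet_succ i hi]
  · rw [ha.sum_eq _ (by omega) le_rfl, ha.hdet_succ i hi, sub_self]

lemma hdet_flip (a : ℕ → ℕ → R) {n c : ℕ} (hc : c ≤ n) :
    hdet (fun i j => a (n - 1 - j) (n - 1 - i)) (n - c) =
      hdet (fun i j => a (c + i) (c + j)) (n - c) := by
  unfold hdet
  rw [← Matrix.det_transpose, ← Matrix.det_submatrix_equiv_self (Fin.revPerm (n := n - c))]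
  congr 1
  ext i j
  simp only [Matrix.submatrix_apply, Matrix.transpose_apply, Matrix.of_apply, Fin.revPerm_apply,
    Fin.val_rev]
  congr 1 <;> omega

lemma IsNegHess.flip {n : ℕ} {a : ℕ → ℕ → R} (ha : IsNegHess n a) :
    IsNegHess n (fun i j => a (n - 1 - j) (n - 1 - i)) := by
  constructor
  · intro i hi
    have := ha.1 (n - 1 - (i + 1)) (by omega)
    rwa [show n - 1 - (i + 1) + 1 = n - 1 - i by omega] at this
  · intro i j hj hij
    exact ha.2 _ _ (by omega) (by omega)

lemma IsNegHess.sum_trail_mul {n : ℕ} {a : ℕ → ℕ → R} (ha : IsNegHess n a) {j : ℕ} (hj : j < n) :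
    ∑ i ∈ Finset.range n, hdet (fun r s => a (i + 1 + r) (i + 1 + s)) (n - (i + 1)) * a i j =
      if j = 0 then hdet a n else 0 := by
  have h := ha.flip.sum_mul_hdet (i := n - 1 - j) (by omega)
  have h0 := hdet_flip a (n := n) (c := 0) (by omega)
  simp only [zero_add, Nat.sub_zero] at h0
  have hiff : n - 1 - j + 1 = n ↔ j = 0 := by omega
  simp only [hiff, h0] at h
  rw [← Finset.sum_range_reflect] at h
  rw [← h]
  refine Finset.sum_congr rfl fun i hi => ?_
  have hi' := Finset.mem_range.1 hi
  rw [← hdet_flip a (by omega), show n - 1 - i = n - (i + 1) by omega,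
    show n - 1 - (n - (i + 1)) = i by omega, show n - 1 - (n - 1 - j) = j by omega, mul_comm]

/-- Perturbing a Hessenberg matrix inside the block of rows `≥ t` and columns `≤ t` changes its
determinant by a linear function of the perturbation. -/
lemma hdet_perturb {n t : ℕ} (hn : 0 < n) {a b : ℕ → ℕ → R} (ha : IsNegHess n a)
    (hb : IsNegHess n b)
    (hab : ∀ i < n, ∀ j < n, ¬ (j ≤ t ∧ t ≤ i) → a i j = b i j) :
    hdet a n = hdet b n + ∑ i ∈ Finset.range n, ∑ j ∈ Finset.range n,
      hdet (fun r s => b (i + 1 + r) (i + 1 + s)) (n - (i + 1)) * (a i j - b i j) * hdet b j := by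
  set T : ℕ → R := fun i => hdet (fun r s => b (i + 1 + r) (i + 1 + s)) (n - (i + 1)) with hT
  have e1 : ∑ i ∈ Finset.range n, T i * ∑ j ∈ Finset.range n, a i j * hdet a j = hdet a n := by
    rw [Finset.sum_eq_single (n - 1)]
    · rw [ha.sum_mul_hdet (by omega), if_pos (by omega)]
      simp [hT, show n - (n - 1 + 1) = 0 by omega, hdet_zero]
    · intro i hi hne
      have := Finset.mem_range.1 hi
      rw [ha.sum_mul_hdet (by omega), if_neg (by omega), mul_zero]
    · simp
      omega
  have e2 : ∑ j ∈ Finset.range n, (∑ i ∈ Finset.range n, T i * b i j) * hdet a j = hdet b n := by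
    rw [Finset.sum_eq_single 0]
    · rw [hb.sum_trail_mul hn, if_pos rfl, hdet_zero, mul_one]
    · intro j hj hne
      rw [hb.sum_trail_mul (Finset.mem_range.1 hj), if_neg hne, zero_mul]
    · simp
      omega
  have e3 : ∑ i ∈ Finset.range n, ∑ j ∈ Finset.range n, T i * (a i j - b i j) * hdet b j =
      ∑ i ∈ Finset.range n, ∑ j ∈ Finset.range n, T i * (a i j - b i j) * hdet a j := by
    refine Finset.sum_congr rfl fun i hi => Finset.sum_congr rfl fun j hj => ?_
    rw [Finset.mem_range] at hi hj
    by_cases h : j ≤ t ∧ t ≤ i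
    · rw [hdet_congr (a := b) (b := a) (m := j)]
      intro r hr s hs
      exact (hab r (by omega) s (by omega) (by omega)).symm
    · rw [hab i hi j hj h]
      simp
  rw [e3]
  nth_rw 1 [← e1]
  rw [← e2]
  simp only [Finset.mul_sum, Finset.sum_mul]
  rw [Finset.sum_comm (f := fun j i => T i * b i j * hdet a j), ← Finset.sum_add_distrib]
  refine Finset.sum_congr rfl fun i _ => ?_
  rw [← Finset.sum_add_distrib]
  refine Finset.sum_congr rfl fun j _ => ?_
  ring

end Hessenberg

section Degrees

variable {F : Type*} [Field F]

lemma LinearIndependent.le_finrank_of_initial_mem {V : Type*} [AddCommGroup V] [Module F V]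
    {N s : ℕ} {p : Fin N → V}
    (hp : LinearIndependent F p) (hs : s ≤ N) (W : Submodule F V) [FiniteDimensional F W]
    (hW : ∀ t : Fin N, (t : ℕ) < s → p t ∈ W) : s ≤ Module.finrank F W := by
  have h1 : LinearIndependent F (fun i : Fin s => p (Fin.castLE hs i)) :=
    hp.comp _ (Fin.castLE_injective hs)
  have h2 : LinearIndependent F (fun i : Fin s => (⟨p (Fin.castLE hs i), hW _ i.2⟩ : W)) :=
    LinearIndependent.of_comp W.subtype h1
  simpa using h2.fintype_card_le_finrank

instance finiteDimensional_degreeLT (m : ℕ) : FiniteDimensional F (degreeLT F m) :=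
  Module.Finite.equiv (degreeLTEquiv F m).symm

lemma finrank_degreeLT_eq (m : ℕ) : Module.finrank F (degreeLT F m) = m := by
  rw [(degreeLTEquiv F m).finrank_eq]
  simp

lemma linearIndependent_of_degree_eq {N : ℕ} (q : Fin N → F[X])
    (hq : ∀ t, (q t).degree = ((t : ℕ) : WithBot ℕ)) : LinearIndependent F q := by
  let S : Polynomial.Sequence F :=
    { elems' := fun i => if h : i < N then q ⟨i, h⟩ else X ^ i
      degree_eq' := fun i => by
        split_ifs with h
        · exact hq ⟨i, h⟩
        · exact degree_X_pow i }
  have hS : q = (fun i => S i) ∘ fun i : Fin N => (i : ℕ) := by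
    ext1 i
    change q i = if h : (i : ℕ) < N then q ⟨i, h⟩ else X ^ (i : ℕ)
    rw [dif_pos i.2]
  rw [hS]
  exact S.linearIndependent.comp _ Fin.val_injective

lemma mem_degreeLT_of_natDegree_lt {q : F[X]} {m : ℕ} (h : q.natDegree < m) :
    q ∈ degreeLT F m :=
  mem_degreeLT.2 (degree_le_natDegree.trans_lt (by exact_mod_cast h))

lemma monic_degree_eq_iff {q : F[X]} (hq : q.Monic) (m : ℕ) :
    q.degree = (m : WithBot ℕ) ↔ q.natDegree = m :=
  degree_eq_iff_natDegree_eq hq.ne_zero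

lemma coeff_sub_eq_zero_of_monic {q r : F[X]} {m : ℕ} (hq : q.Monic) (hr : r.Monic)
    (hqm : q.natDegree = m + 1) (hrm : r.natDegree = m + 1) {k : ℕ} (hk : m < k) :
    (q - r).coeff k = 0 := by
  rw [coeff_sub, sub_eq_zero]
  rcases eq_or_lt_of_le (Nat.succ_le_of_lt hk) with h' | h'
  · have h1 := hq.coeff_natDegree
    have h2 := hr.coeff_natDegree
    rw [hqm] at h1
    rw [hrm] at h2
    rw [← h', Nat.succ_eq_add_one, h1, h2]
  · rw [coeff_eq_zero_of_natDegree_lt (by omega), coeff_eq_zero_of_natDegree_lt (by omega)]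

lemma sub_mem_degreeLT_of_coeff_eq {q r : F[X]} {m : ℕ} (hq : q.Monic) (hr : r.Monic)
    (hqm : q.natDegree = m + 1) (hrm : r.natDegree = m + 1) (h : q.coeff m = r.coeff m) :
    q - r ∈ degreeLT F m := by
  rw [mem_degreeLT, degree_lt_iff_coeff_zero]
  intro k hk
  rcases eq_or_lt_of_le hk with rfl | hk
  · rw [coeff_sub, h, sub_self]
  · exact coeff_sub_eq_zero_of_monic hq hr hqm hrm hk

lemma degree_sub_eq_of_coeff_ne {q r : F[X]} {m : ℕ} (hq : q.Monic) (hr : r.Monic)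
    (hqm : q.natDegree = m + 1) (hrm : r.natDegree = m + 1) (h : q.coeff m ≠ r.coeff m) :
    (q - r).degree = (m : WithBot ℕ) := by
  apply le_antisymm
  · rw [degree_le_iff_coeff_zero]
    intro k hk
    exact coeff_sub_eq_zero_of_monic hq hr hqm hrm (by exact_mod_cast hk)
  · exact le_degree_of_ne_zero (by rwa [coeff_sub, sub_ne_zero])

/-- For monic polynomials whose degrees weakly increase up to `n`, linear independence together
with the absence of two consecutive indices `t` with `deg p_t ≠ t` is a local condition. -/
lemma linearIndependent_and_short_iff {n : ℕ} (p : ℕ → F[X]) (hm : ∀ t ≤ n, (p t).Monic)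
    (hmono : ∀ s t, s ≤ t → t ≤ n → (p s).natDegree ≤ (p t).natDegree)
    (hn : (p n).natDegree = n) :
    (LinearIndependent F (fun i : Fin (n + 1) => p i) ∧
      ∀ t < n, (p t).natDegree = t ∨ (p (t + 1)).natDegree = t + 1) ↔
    ∀ t < n, (p t).natDegree = t ∨ ((p t).natDegree = t + 1 ∧ (p (t + 1)).natDegree = t + 1 ∧
      (p (t + 1)).coeff t ≠ (p t).coeff t) := by
  constructor
  · rintro ⟨hli, hshort⟩ t ht
    have hge : ∀ s ≤ n, s ≤ (p s).natDegree := by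
      intro s hs
      have := hli.le_finrank_of_initial_mem (s := s + 1) (by omega)
        (degreeLT F ((p s).natDegree + 1)) (fun i hi => mem_degreeLT_of_natDegree_lt
          (Nat.lt_succ_of_le (hmono i s (by omega) hs)))
      rw [finrank_degreeLT_eq] at this
      omega
    by_cases h : (p t).natDegree = t
    · exact Or.inl h
    have h1 := (hshort t ht).resolve_left h
    have h2 : (p t).natDegree = t + 1 := by
      have := hge t (by omega)
      have := hmono t (t + 1) (by omega) (by omega)
      omega
    refine Or.inr ⟨h2, h1, fun hc => ?_⟩
    have hlow : ∀ s < t, (p s).natDegree < t := by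
      intro s hs
      have h3 : (p (t - 1)).natDegree = t - 1 := by
        rcases hshort (t - 1) (by omega) with h3 | h3
        · exact h3
        · rw [show t - 1 + 1 = t by omega] at h3
          exact absurd h3 h
      have := hmono s (t - 1) (by omega) (by omega)
      omega
    have hdiff := sub_mem_degreeLT_of_coeff_eq (hm _ (by omega)) (hm _ (by omega)) h1 h2 hc
    have hle := hli.le_finrank_of_initial_mem (s := t + 2) (by omega)
      (degreeLT F t ⊔ F ∙ p t) (by
        intro i hi
        rcases lt_trichotomy (i : ℕ) t with h' | h' | h'
        · exact Submodule.mem_sup_left (mem_degreeLT_of_natDegree_lt (hlow i h'))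
        · simp only [h']
          exact Submodule.mem_sup_right (Submodule.mem_span_singleton_self _)
        · have : (i : ℕ) = t + 1 := by omega
          simp only [this]
          rw [← sub_add_cancel (p (t + 1)) (p t)]
          exact Submodule.add_mem_sup hdiff (Submodule.mem_span_singleton_self _))
    have h4 := Submodule.finrank_add_le_finrank_add_finrank (degreeLT F t) (F ∙ p t)
    rw [finrank_degreeLT_eq] at h4
    have h5 := finrank_span_singleton (K := F) (hm t (by omega)).ne_zero
    omega
  · intro H
    refine ⟨?_, fun t ht => (H t ht).imp_right fun h => h.2.1⟩
    let q : Fin (n + 1) → F[X] := fun i => if (p i).natDegree = i then p i else p (i + 1) - p i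
    have hq : ∀ i, (q i).degree = ((i : ℕ) : WithBot ℕ) := by
      intro i
      by_cases h : (p i).natDegree = i
      · simp only [q, if_pos h]
        rwa [monic_degree_eq_iff (hm i (by omega))]
      · simp only [q, if_neg h]
        have hin : (i : ℕ) < n := by
          by_contra hc
          have : (i : ℕ) = n := by omega
          exact h (by rw [this, hn])
        obtain ⟨h1, h2, h3⟩ := (H i hin).resolve_left h
        exact degree_sub_eq_of_coeff_ne (hm _ (by omega)) (hm _ (by omega)) h2 h1 h3
    have hqspan : Submodule.span F (Set.range q) ≤
        Submodule.span F (Set.range fun i : Fin (n + 1) => p i) := by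
      rw [Submodule.span_le]
      rintro _ ⟨i, rfl⟩
      have hmem : ∀ t ≤ n, p t ∈ Submodule.span F (Set.range fun i : Fin (n + 1) => p i) :=
        fun t ht => Submodule.subset_span ⟨⟨t, by omega⟩, rfl⟩
      by_cases h : (p i).natDegree = i
      · simp only [q, if_pos h]
        exact hmem i (by omega)
      · simp only [q, if_neg h]
        have hin : (i : ℕ) < n := by
          by_contra hc
          have : (i : ℕ) = n := by omega
          exact h (by rw [this, hn])
        exact Submodule.sub_mem _ (hmem _ (by omega)) (hmem _ (by omega))
    rw [linearIndependent_iff_card_le_finrank_span]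
    have h1 := finrank_span_eq_card (linearIndependent_of_degree_eq q hq)
    have : FiniteDimensional F (Submodule.span F (Set.range fun i : Fin (n + 1) => p i)) :=
      FiniteDimensional.span_of_finite F (Set.finite_range _)
    have h2 := Submodule.finrank_mono hqspan
    unfold Set.finrank
    omega

/-- All blocks cut out by the indices satisfying `g` have length at most two iff no two
consecutive indices fail `g`. -/
lemma blocks_short_iff {n : ℕ} (g : ℕ → Prop) (hg : g n) :
    (∀ b e : ℕ, b ≤ e → e ≤ n → g e → (∀ t, b ≤ t → t < e → ¬ g t) → (b = 0 ∨ g (b - 1)) →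
      e ≤ b + 1) ↔ ∀ t < n, g t ∨ g (t + 1) := by
  classical
  constructor
  · intro H t ht
    by_contra! hc
    have hex : ∃ e, t + 2 ≤ e ∧ e ≤ n ∧ g e := by
      refine ⟨n, ?_, le_rfl, hg⟩
      by_contra h
      have : n = t + 1 := by omega
      exact hc.2 (this ▸ hg)
    obtain ⟨he1, he2, he3⟩ := Nat.find_spec hex
    set e := Nat.find hex with he
    have hbad : ∀ s, t ≤ s → s < e → ¬ g s := by
      intro s hs hse hgs
      rcases eq_or_ne s t with rfl | h1
      · exact hc.1 hgs
      rcases eq_or_ne s (t + 1) with rfl | h2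
      · exact hc.2 hgs
      exact Nat.find_min hex hse ⟨by omega, by omega, hgs⟩
    have hbex : ∃ b, ∀ s, b ≤ s → s < e → ¬ g s := ⟨t, hbad⟩
    have hbs := Nat.find_spec hbex
    have hbt := Nat.find_min' hbex hbad
    set b := Nat.find hbex with hb
    have := H b e (by omega) he2 he3 hbs (by
      by_cases hb0 : b = 0
      · exact Or.inl hb0
      right
      by_contra hgb
      refine Nat.find_min hbex (m := b - 1) (by omega) fun s hs hse => ?_
      rcases eq_or_ne s (b - 1) with rfl | h1
      · exact hgb
      · exact hbs s (by omega) hse)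
    omega
  · intro H b e hbe hen hge hbad _
    by_contra hlt
    rcases H b (by omega) with h | h
    · exact hbad b le_rfl (by omega) h
    · exact hbad (b + 1) (by omega) (by omega) h

end Degrees

section Charpoly

variable {F : Type*} [Field F] {n : ℕ}

/-- Extension by zero of a square matrix to an `ℕ`-indexed array. -/
def extendZero {R : Type*} [Zero R] (M : Matrix (Fin n) (Fin n) R) (i j : ℕ) : R :=
  if h : i < n ∧ j < n then M ⟨i, h.1⟩ ⟨j, h.2⟩ else 0

lemma extendZero_val {R : Type*} [Zero R] (M : Matrix (Fin n) (Fin n) R) (i j : Fin n) :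
    extendZero M i j = M i j :=
  dif_pos ⟨i.2, j.2⟩

lemma extendZero_of_lt {R : Type*} [Zero R] (M : Matrix (Fin n) (Fin n) R) {i j : ℕ} (hi : i < n)
    (hj : j < n) : extendZero M i j = M ⟨i, hi⟩ ⟨j, hj⟩ :=
  dif_pos ⟨hi, hj⟩

lemma hdet_extendZero {R : Type*} [CommRing R] (M : Matrix (Fin n) (Fin n) R) :
    hdet (extendZero M) n = M.det := by
  unfold hdet
  congr 1
  ext i j
  exact extendZero_val M i j

lemma IsULH.isNegHess_charmatrix {R : Type*} [CommRing R] {M : Matrix (Fin n) (Fin n) R}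
    (hM : IsULH M) : IsNegHess n (extendZero M.charmatrix) := by
  constructor
  · intro i hi
    rw [extendZero_of_lt _ (by omega) hi, charmatrix_apply_ne _ _ _ (by simp), hM.1 _ _ rfl]
    simp
  · intro i j hj hij
    rw [extendZero_of_lt _ (by omega) hj,
      charmatrix_apply_ne _ _ _ (by simp only [ne_eq, Fin.mk.injEq]; omega), hM.2 _ _ hij]
    simp

lemma hdet_charmatrix_leadSub {R : Type*} [CommRing R] (M : Matrix (Fin n) (Fin n) R) (m : ℕ)
    (h : m ≤ n) : hdet (extendZero M.charmatrix) m = (leadSub M m h).charpoly := by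
  unfold hdet Matrix.charpoly
  congr 1
  ext1 i j
  rw [Matrix.of_apply, extendZero_of_lt _ (by omega) (by omega), charmatrix_apply, charmatrix_apply]
  simp [leadSub, Matrix.diagonal_apply, Fin.ext_iff, Fin.castLE]

lemma hdet_charmatrix_trailSub {R : Type*} [CommRing R] (M : Matrix (Fin n) (Fin n) R) (c m : ℕ)
    (h : c + m = n) : hdet (fun i j => extendZero M.charmatrix (c + i) (c + j)) m =
      (trailSub M m (by omega)).charpoly := by
  obtain rfl : c = n - m := by omega
  unfold hdet Matrix.charpoly
  congr 1
  ext1 i j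
  rw [Matrix.of_apply]
  change extendZero M.charmatrix (n - m + i) (n - m + j) = charmatrix (trailSub M m (by omega)) i j
  rw [extendZero_of_lt _ (by omega) (by omega), charmatrix_apply, charmatrix_apply]
  simp [trailSub, Matrix.diagonal_apply, Fin.ext_iff]

variable {pos : Fin n → Fin n × Fin n} {A : Matrix (Fin n) (Fin n) (MvPolynomial (Fin n) F)}

lemma IsHPos.injective (hpos : IsHPos pos) : Function.Injective pos := by
  intro k l hkl
  by_contra hne
  rcases lt_or_gt_of_ne hne with h | h
  · have := hpos.2 _ _ h
    rw [hkl] at this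
    unfold Prec at this
    omega
  · have := hpos.2 _ _ h
    rw [hkl] at this
    unfold Prec at this
    omega

lemma sum_X_eq_zero_of_lt (hpos : IsHPos pos) {i j : Fin n} (hij : (i : ℕ) < j) :
    (∑ k : Fin n, if pos k = (i, j) then (MvPolynomial.X k : MvPolynomial (Fin n) F) else 0) = 0 :=
  Finset.sum_eq_zero fun k _ => if_neg fun h => by
    have := hpos.1 k
    rw [h] at this
    simp only at this
    omega

lemma constPart_HMat (i j : Fin n) :
    constPart (HMat F pos) i j = if (j : ℕ) = (i : ℕ) + 1 then 1 else 0 := by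
  have : ∀ k : Fin n, MvPolynomial.eval (fun _ => (0 : F))
      (if pos k = (i, j) then (MvPolynomial.X k : MvPolynomial (Fin n) F) else 0) = 0 := by
    intro k
    split_ifs <;> simp
  simp only [constPart, HMat, Matrix.map_apply, map_add, map_sum, this, Finset.sum_const_zero,
    add_zero]
  split_ifs <;> simp

lemma HMat_apply (i j : Fin n) :
    HMat F pos i j = MvPolynomial.C (constPart (HMat F pos) i j) +
      ∑ k : Fin n, if pos k = (i, j) then MvPolynomial.X k else 0 := by
  rw [constPart_HMat]
  unfold HMat
  congr 1
  split_ifs <;> simp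

lemma IsULHSuperpatternOf.apply_eq (hA : IsULHSuperpatternOf A (HMat F pos)) (i j : Fin n) :
    A i j = MvPolynomial.C (constPart A i j) +
      ∑ k : Fin n, if pos k = (i, j) then MvPolynomial.X k else 0 := by
  have hcase : A i j = HMat F pos i j ∨
      ((j : ℕ) ≤ i ∧ HMat F pos i j = 0 ∧ ∃ c : F, A i j = MvPolynomial.C c) := by
    rcases lt_or_ge (i : ℕ) (j : ℕ) with h | h
    · exact Or.inl (hA.1 i j h)
    · rcases hA.2 i j h with h' | ⟨h1, c, -, h2⟩
      · exact Or.inl h'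
      · exact Or.inr ⟨h, h1, c, h2⟩
  rcases hcase with h | ⟨hle, h0, c, hc⟩
  · rw [h, show constPart A i j = constPart (HMat F pos) i j by
      simp only [constPart, Matrix.map_apply, h]]
    exact HMat_apply i j
  · rw [HMat_apply, constPart_HMat, if_neg (by omega), map_zero, zero_add] at h0
    rw [h0, add_zero]
    simp only [constPart, Matrix.map_apply, hc, MvPolynomial.eval_C]

lemma IsULHSuperpatternOf.isULH_constPart (hA : IsULHSuperpatternOf A (HMat F pos)) :
    IsULH (constPart A) := by
  have h : ∀ i j : Fin n, (i : ℕ) < j → constPart A i j = if (j : ℕ) = i + 1 then 1 else 0 := by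
    intro i j hij
    rw [← constPart_HMat (pos := pos)]
    simp only [constPart, Matrix.map_apply, hA.1 i j hij]
  exact ⟨fun i j hij => by rw [h i j (by omega), if_pos hij],
    fun i j hij => by rw [h i j (by omega), if_neg (by omega)]⟩

lemma IsULH.map_C {M : Matrix (Fin n) (Fin n) F} (hM : IsULH M) :
    IsULH (M.map (MvPolynomial.C : F →+* MvPolynomial (Fin n) F)) :=
  ⟨fun i j h => by simp [hM.1 i j h], fun i j h => by simp [hM.2 i j h]⟩

lemma IsULHSuperpatternOf.isULH (hpos : IsHPos pos) (hA : IsULHSuperpatternOf A (HMat F pos)) :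
    IsULH A := by
  have h : ∀ i j : Fin n, (i : ℕ) < j → A i j = MvPolynomial.C (constPart A i j) := by
    intro i j hij
    rw [hA.apply_eq, sum_X_eq_zero_of_lt hpos hij, add_zero]
  exact ⟨fun i j hij => by rw [h i j (by omega), hA.isULH_constPart.1 i j hij, map_one],
    fun i j hij => by rw [h i j (by omega), hA.isULH_constPart.2 i j hij, map_zero]⟩

lemma sub_one_sub_le (n i : ℕ) : n - 1 - i ≤ n :=
  (Nat.sub_le _ _).trans (Nat.sub_le _ _)

/-- The characteristic polynomial of a superpattern of a matrix of `ℬ` is affine in the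
variables. -/
lemma IsULHSuperpatternOf.charpoly_eq (hpos : IsBPos pos)
    (hA : IsULHSuperpatternOf A (HMat F pos)) :
    A.charpoly = (constPart A).charpoly.map (MvPolynomial.C : F →+* MvPolynomial (Fin n) F) -
      ∑ k : Fin n, Polynomial.C (MvPolynomial.X k) *
        ((leadSub (constPart A) ((pos k).2 : ℕ) ((pos k).2).isLt.le).charpoly *
          (trailSub (constPart A) (n - 1 - ((pos k).1 : ℕ)) (sub_one_sub_le n _)).charpoly).map
            (MvPolynomial.C : F →+* MvPolynomial (Fin n) F) := by
  rcases Nat.eq_zero_or_pos n with rfl | hn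
  · simp [Matrix.charpoly]
  set φ : F →+* MvPolynomial (Fin n) F := MvPolynomial.C with hφ
  set A₀ := (constPart A).map φ with hA₀
  obtain ⟨t, ht1, ht2⟩ : ∃ t, (∀ k, ((pos k).2 : ℕ) ≤ t) ∧ ∀ k, t ≤ ((pos k).1 : ℕ) :=
    ⟨Finset.univ.sup fun k => ((pos k).2 : ℕ), fun k => Finset.le_sup
      (f := fun k => ((pos k).2 : ℕ)) (Finset.mem_univ k),
      fun l => Finset.sup_le fun k _ => hpos.2 k l⟩
  have hdiff : ∀ i j : Fin n, A.charmatrix i j - A₀.charmatrix i j =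
      -∑ k : Fin n, if pos k = (i, j) then
        (Polynomial.C (MvPolynomial.X k) : (MvPolynomial (Fin n) F)[X]) else 0 := by
    intro i j
    rw [charmatrix_apply, charmatrix_apply, hA.apply_eq i j]
    simp only [hA₀, Matrix.map_apply, hφ, map_add, map_sum, apply_ite Polynomial.C, map_zero]
    ring
  have key := hdet_perturb (t := t) hn (hA.isULH hpos.1).isNegHess_charmatrix
    hA.isULH_constPart.map_C.isNegHess_charmatrix (by
      intro i hi j hj hij
      rw [extendZero_of_lt _ hi hj, extendZero_of_lt _ hi hj, ← sub_eq_zero, hdiff,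
        Finset.sum_eq_zero, neg_zero]
      intro k _
      refine if_neg fun h => hij ?_
      have h1 := ht1 k
      have h2 := ht2 k
      rw [h] at h1 h2
      exact ⟨h1, h2⟩)
  rw [hdet_extendZero, hdet_extendZero] at key
  change A.charpoly = A₀.charpoly + _ at key
  rw [key, hA₀, Matrix.charpoly_map, sub_eq_add_neg, Finset.sum_range, ← hA₀]
  congr 1
  simp only [Finset.sum_range (n := n), extendZero_val, hdiff, mul_neg, neg_mul,
    Finset.sum_neg_distrib, neg_inj, Finset.mul_sum, Finset.sum_mul]
  have hswap : ∀ f : Fin n → Fin n → Fin n → (MvPolynomial (Fin n) F)[X],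
      ∑ i, ∑ j, ∑ k, f i j k = ∑ k, ∑ i, ∑ j, f i j k := by
    intro f
    rw [Finset.sum_comm (f := fun k i => ∑ j, f i j k)]
    exact Finset.sum_congr rfl fun i _ => Finset.sum_comm
  rw [hswap]
  refine Finset.sum_congr rfl fun k _ => ?_
  rw [Finset.sum_eq_single (pos k).1, Finset.sum_eq_single (pos k).2]
  · rw [if_pos rfl, hdet_charmatrix_leadSub _ _ ((pos k).2).isLt.le,
      show n - (((pos k).1 : ℕ) + 1) = n - 1 - ((pos k).1 : ℕ) by omega,
      hdet_charmatrix_trailSub _ _ _ (by omega), Polynomial.map_mul, ← Matrix.charpoly_map,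
      ← Matrix.charpoly_map]
    change _ = Polynomial.C (MvPolynomial.X k) *
      ((leadSub A₀ ((pos k).2 : ℕ) ((pos k).2).isLt.le).charpoly *
        (trailSub A₀ (n - 1 - ((pos k).1 : ℕ)) (sub_one_sub_le n _)).charpoly)
    ring
  · intro j _ hj
    rw [if_neg (fun h => hj (by rw [h])), mul_zero, zero_mul]
  · simp
  · intro i _ hi
    refine Finset.sum_eq_zero fun j _ => ?_
    rw [if_neg (fun h => hi (by rw [h])), mul_zero, zero_mul]
  · simp

end Charpoly

section Main

variable {F : Type*} [Field F] {n : ℕ}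

lemma trace_leadSub_add_trace_trailSub {R : Type*} [AddCommGroup R] (M : Matrix (Fin n) (Fin n) R)
    {i j : ℕ} (hij : j ≤ i) (hi : i < n) :
    (leadSub M j (by omega)).trace + (trailSub M (n - 1 - i) (by omega)).trace =
      M.trace - ∑ r : Fin n, if j ≤ (r : ℕ) ∧ (r : ℕ) ≤ i then M r r else 0 := by
  have h1 : (leadSub M j (by omega)).trace = ∑ r ∈ Finset.range j, extendZero M r r := by
    rw [Finset.sum_range]
    refine Finset.sum_congr rfl fun r _ => ?_
    exact (extendZero_of_lt M (by omega) (by omega)).symm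
  have h2 : (trailSub M (n - 1 - i) (by omega)).trace =
      ∑ r ∈ Finset.Ico (i + 1) n, extendZero M r r := by
    rw [Finset.sum_Ico_eq_sum_range, show n - (i + 1) = n - 1 - i by omega, Finset.sum_range]
    refine Finset.sum_congr rfl fun r _ => ?_
    rw [show i + 1 = n - (n - 1 - i) by omega, extendZero_of_lt M (by omega) (by omega)]
    rfl
  have h3 : M.trace = ∑ r ∈ Finset.range n, extendZero M r r := by
    rw [Finset.sum_range]
    exact Finset.sum_congr rfl fun r _ => (extendZero_val M r r).symm
  have h4 : (∑ r : Fin n, if j ≤ (r : ℕ) ∧ (r : ℕ) ≤ i then M r r else 0) =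
      ∑ r ∈ Finset.Ico j (i + 1), extendZero M r r := by
    simp only [← extendZero_val M]
    rw [← Finset.sum_range fun r => if j ≤ r ∧ r ≤ i then extendZero M r r else 0,
      ← Finset.sum_filter]
    refine Finset.sum_congr ?_ fun _ _ => rfl
    ext r
    simp only [Finset.mem_filter, Finset.mem_range, Finset.mem_Ico]
    omega
  rw [h1, h2, h3, h4, ← Finset.sum_range_add_sum_Ico _ (show j ≤ n by omega),
    ← Finset.sum_Ico_consecutive _ (show j ≤ i + 1 by omega) (show i + 1 ≤ n by omega)]
  abel

lemma monic_lead_mul_trail (M : Matrix (Fin n) (Fin n) F) {a b : ℕ} (ha : a ≤ n) (hb : b ≤ n) :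
    ((leadSub M a ha).charpoly * (trailSub M b hb).charpoly).Monic :=
  (charpoly_monic _).mul (charpoly_monic _)

lemma natDegree_lead_mul_trail (M : Matrix (Fin n) (Fin n) F) {a b : ℕ} (ha : a ≤ n) (hb : b ≤ n) :
    ((leadSub M a ha).charpoly * (trailSub M b hb).charpoly).natDegree = a + b := by
  rw [(charpoly_monic _).natDegree_mul (charpoly_monic _), charpoly_natDegree_eq_dim,
    charpoly_natDegree_eq_dim, Fintype.card_fin, Fintype.card_fin]

lemma coeff_lead_mul_trail (M : Matrix (Fin n) (Fin n) F) {i j m : ℕ} (hij : j ≤ i) (hi : i < n)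
    (hm : j + (n - 1 - i) = m + 1) :
    ((leadSub M j (by omega)).charpoly * (trailSub M (n - 1 - i) (by omega)).charpoly).coeff m =
      (∑ r : Fin n, if j ≤ (r : ℕ) ∧ (r : ℕ) ≤ i then M r r else 0) - M.trace := by
  have hdeg := natDegree_lead_mul_trail M (show j ≤ n by omega) (show n - 1 - i ≤ n by omega)
  have h := nextCoeff_of_natDegree_pos (m.succ_pos.trans_eq (hdeg.trans hm).symm)
  rw [hdeg, hm, Nat.add_sub_cancel] at h
  rw [← h, (charpoly_monic _).nextCoeff_mul (charpoly_monic _),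
    ← neg_inj, neg_add, ← trace_eq_neg_charpoly_nextCoeff, ← trace_eq_neg_charpoly_nextCoeff,
    trace_leadSub_add_trace_trailSub M hij hi]
  ring

variable {pos : Fin n → Fin n × Fin n} {A : Matrix (Fin n) (Fin n) (MvPolynomial (Fin n) F)}

/-- The part of a diagonal segment sum coming from the variables is the same for all variables. -/
lemma IsULHSuperpatternOf.diag_sum_eq (hpos : IsBPos pos)
    (hA : IsULHSuperpatternOf A (HMat F pos)) (k : Fin n) :
    (∑ t : Fin n, if ((pos k).2 : ℕ) ≤ (t : ℕ) ∧ (t : ℕ) ≤ ((pos k).1 : ℕ) then A t t else 0) =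
      MvPolynomial.C (∑ t : Fin n, if ((pos k).2 : ℕ) ≤ (t : ℕ) ∧ (t : ℕ) ≤ ((pos k).1 : ℕ) then
        constPart A t t else 0) +
      ∑ l : Fin n, if (pos l).1 = (pos l).2 then MvPolynomial.X l else 0 := by
  have h : ∀ t : Fin n, (if ((pos k).2 : ℕ) ≤ (t : ℕ) ∧ (t : ℕ) ≤ ((pos k).1 : ℕ) then
      A t t else 0) = MvPolynomial.C (if ((pos k).2 : ℕ) ≤ (t : ℕ) ∧ (t : ℕ) ≤ ((pos k).1 : ℕ) then
        constPart A t t else 0) + ∑ l : Fin n, if pos l = (t, t) then MvPolynomial.X l else 0 := by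
    intro t
    split_ifs with ht
    · exact hA.apply_eq t t
    · rw [map_zero, zero_add, Finset.sum_eq_zero]
      intro l _
      refine if_neg fun hl => ht ?_
      have h1 := hpos.2 k l
      have h2 := hpos.2 l k
      rw [hl] at h1 h2
      exact ⟨h1, h2⟩
  rw [Finset.sum_congr rfl fun t _ => h t, Finset.sum_add_distrib, ← map_sum, Finset.sum_comm]
  congr 1
  refine Finset.sum_congr rfl fun l _ => ?_
  rw [Finset.sum_eq_single (pos l).1]
  · refine if_congr ?_ rfl rfl
    rw [Prod.ext_iff]
    exact ⟨fun h => h.2.symm, fun h => ⟨rfl, h.symm⟩⟩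
  · intro t _ ht
    exact if_neg fun h => ht (by rw [h])
  · simp

lemma IsULHSuperpatternOf.apply_pos (hpos : IsHPos pos) (hA : IsULHSuperpatternOf A (HMat F pos))
    (k : Fin n) : A (pos k).1 (pos k).2 = MvPolynomial.X k := by
  have hle := hpos.1 k
  have hH : HMat F pos (pos k).1 (pos k).2 = MvPolynomial.X k := by
    unfold HMat
    rw [if_neg (by omega), zero_add, Finset.sum_eq_single k]
    · simp
    · intro l _ hl
      exact if_neg fun h => hl (hpos.injective h)
    · simp
  rcases hA.2 _ _ hle with h | ⟨h, -⟩
  · rw [h, hH]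
  · rw [hH] at h
    exact absurd h (MvPolynomial.X_ne_zero k)

/-- A polynomial affine in the variables determines its coefficient polynomials. -/
lemma affine_expansion_unique {p₀ q₀ : F[X]} {p q : Fin n → F[X]}
    (h : p₀.map (MvPolynomial.C : F →+* MvPolynomial (Fin n) F) -
        ∑ k : Fin n, Polynomial.C (MvPolynomial.X k) * (p k).map MvPolynomial.C =
      q₀.map (MvPolynomial.C : F →+* MvPolynomial (Fin n) F) -
        ∑ k : Fin n, Polynomial.C (MvPolynomial.X k) * (q k).map MvPolynomial.C) :
    p₀ = q₀ ∧ ∀ k, p k = q k := by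
  have hev : ∀ v : Fin n → F, p₀ - ∑ k, Polynomial.C (v k) * p k =
      q₀ - ∑ k, Polynomial.C (v k) * q k := by
    intro v
    have h1 := congrArg (Polynomial.map (MvPolynomial.eval v)) h
    have h2 : (MvPolynomial.eval v).comp MvPolynomial.C = RingHom.id F := by
      ext; simp
    simpa [Polynomial.map_sub, Polynomial.map_sum, Polynomial.map_map, h2] using h1
  have h0 : p₀ = q₀ := by simpa using hev 0
  refine ⟨h0, fun k => ?_⟩
  have h1 := hev (Pi.single k 1)
  rw [h0, sub_right_inj, Finset.sum_eq_single k, Finset.sum_eq_single k] at h1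
  · simpa using h1
  all_goals simp +contextual [Pi.single_eq_of_ne]

lemma IsULHSuperpatternOf.isPBCompanion_iff (hpos : IsBPos pos)
    (hA : IsULHSuperpatternOf A (HMat F pos)) (p : Fin (n + 1) → F[X])
    (hpn : p ⟨n, n.lt_succ_self⟩ = (constPart A).charpoly)
    (hpk : ∀ k : Fin n, p ⟨n - 1 - (k : ℕ), by omega⟩ =
      (leadSub (constPart A) ((pos k).2 : ℕ) ((pos k).2).isLt.le).charpoly *
      (trailSub (constPart A) (n - 1 - ((pos k).1 : ℕ)) (sub_one_sub_le n _)).charpoly)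
    (hdeg : ∀ i, p i ∈ degreeLT F (n + 1)) :
    IsPBCompanion A ↔ LinearIndependent F p := by
  have hchar := hA.charpoly_eq hpos
  rw [← hpn] at hchar
  simp only [← hpk] at hchar
  constructor
  · rintro ⟨-, q, -, hq, -, hchar'⟩
    obtain ⟨h1, h2⟩ := affine_expansion_unique (hchar.symm.trans hchar')
    have : p = q := by
      ext1 i
      rcases eq_or_lt_of_le (Nat.le_of_lt_succ i.2) with hi | hi
      · rwa [show i = ⟨n, n.lt_succ_self⟩ from Fin.ext hi]
      · have h3 := h2 ⟨n - 1 - i, by omega⟩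
        rwa [show (⟨n - 1 - (n - 1 - (i : ℕ)), by omega⟩ : Fin (n + 1)) = i from
          Fin.ext (by simp only; omega)] at h3
    rwa [this]
  · intro hli
    refine ⟨⟨pos, hpos.1.injective, hA.apply_pos hpos.1, fun i j hij => ?_⟩, p, hdeg, hli, ?_,
      hchar⟩
    · refine ⟨constPart A i j, ?_⟩
      rw [hA.apply_eq, Finset.sum_eq_zero fun k _ => if_neg (hij k), add_zero]
    · refine Submodule.eq_of_le_of_finrank_eq (Submodule.span_le.2 ?_) ?_
      · rintro _ ⟨i, rfl⟩
        exact hdeg i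
      · rw [finrank_span_eq_card hli, finrank_degreeLT_eq, Fintype.card_fin]

lemma IsULHSuperpatternOf.diag_sum_ne_iff (hpos : IsBPos pos)
    (hA : IsULHSuperpatternOf A (HMat F pos)) (k l : Fin n) :
    ((∑ t : Fin n, if ((pos k).2 : ℕ) ≤ (t : ℕ) ∧ (t : ℕ) ≤ ((pos k).1 : ℕ) then A t t else 0) ≠
      ∑ t : Fin n, if ((pos l).2 : ℕ) ≤ (t : ℕ) ∧ (t : ℕ) ≤ ((pos l).1 : ℕ) then A t t else 0) ↔
    (∑ t : Fin n, if ((pos k).2 : ℕ) ≤ (t : ℕ) ∧ (t : ℕ) ≤ ((pos k).1 : ℕ) then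
        constPart A t t else 0) ≠
      ∑ t : Fin n, if ((pos l).2 : ℕ) ≤ (t : ℕ) ∧ (t : ℕ) ≤ ((pos l).1 : ℕ) then
        constPart A t t else 0 := by
  rw [hA.diag_sum_eq hpos, hA.diag_sum_eq hpos, ne_eq, add_left_inj, MvPolynomial.C_inj]

lemma IsHPos.sub_mono (hpos : IsHPos pos) {k l : Fin n} (h : k ≤ l) :
    ((pos k).1 : ℕ) - (pos k).2 ≤ (pos l).1 - (pos l).2 := by
  rcases eq_or_lt_of_le h with rfl | h
  · exact le_rfl
  · have := hpos.2 k l h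
    unfold Prec at this
    omega

/-- Rewriting a condition on each variable as a condition on each subdiagonal. -/
lemma subdiagonal_conditions_iff (d : ℕ → ℕ) (hd : ∀ l < n, d l < n) (tr : ℕ → ℕ → Prop) :
    (∀ l < n, d l = l ∨ ∃ k, l = k + 1 ∧ d l = k ∧ d k = k ∧ tr k l) ↔
    ∀ k < n, (∀ l < n, (d l = k ↔ l = k)) ∨
      (k + 1 < n ∧ (∀ l < n, (d l = k ↔ l = k ∨ l = k + 1)) ∧ tr k (k + 1)) ∨
      ∀ l < n, d l ≠ k := by
  constructor
  · intro H k hk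
    have hcase : ∀ l < n, d l = k → l = k ∨ l = k + 1 := by
      intro l hl hlk
      rcases H l hl with h | ⟨m, h1, h2, -, -⟩ <;> omega
    by_cases h1 : k + 1 < n ∧ d (k + 1) = k
    · rcases H (k + 1) h1.1 with h | ⟨m, h2, h3, h4, h5⟩
      · omega
      obtain rfl : m = k := by omega
      refine Or.inr (Or.inl ⟨h1.1, fun l hl => ⟨hcase l hl, ?_⟩, h5⟩)
      rintro (rfl | rfl)
      · exact h4
      · exact h3
    · have hcase' : ∀ l < n, d l = k → l = k := by
        intro l hl hlk
        rcases hcase l hl hlk with h | rfl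
        · exact h
        · exact absurd ⟨hl, hlk⟩ h1
      by_cases h2 : d k = k
      · refine Or.inl fun l hl => ⟨hcase' l hl, ?_⟩
        rintro rfl
        exact h2
      · refine Or.inr (Or.inr fun l hl hlk => h2 ?_)
        have := hcase' l hl hlk
        rwa [this] at hlk
  · intro H l hl
    rcases H (d l) (hd l hl) with h | ⟨h1, h2, h3⟩ | h
    · exact Or.inl ((h l hl).1 rfl).symm
    · rcases (h2 l hl).1 rfl with h | h
      · exact Or.inl h.symm
      · refine Or.inr ⟨d l, h, rfl, (h2 (d l) (hd l hl)).2 (Or.inl rfl), ?_⟩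
        rwa [← h] at h3
    · exact absurd rfl (h l hl)

end Main

/-- A matrix `A ∈ ℬ̃` is a PB-companion matrix whose associated
concatenation has all components of length one or two iff every `k`-subdiagonal of
`A` (for `0 ≤ k ≤ n−1`) satisfies: (I) the only variable on it is `x_{k+1}`; or
(II) the only variables on it are `x_{k+1}` at `(i, i−k)` and `x_{k+2}` at
`(i′, i′−k)` and `Σ_{r=i−k}^{i} a_{rr} ≠ Σ_{r=i′−k}^{i′} a_{rr}`; or (III) no
variable appears on it. -/
theorem pbCompanion_short_components_iff {F : Type*} [Field F] {n : ℕ} (hn : 0 < n)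
    (pos : Fin n → Fin n × Fin n) (hpos : IsBPos pos)
    (A : Matrix (Fin n) (Fin n) (MvPolynomial (Fin n) F))
    (hA : IsULHSuperpatternOf A (HMat F pos))
    (p : Fin (n + 1) → Polynomial F)
    (hpn : p ⟨n, n.lt_succ_self⟩ = (constPart A).charpoly)
    (hpk : ∀ k : Fin n, p ⟨n - 1 - (k : ℕ), by omega⟩ =
      (leadSub (constPart A) ((pos k).2 : ℕ) ((pos k).2).isLt.le).charpoly *
      (trailSub (constPart A) (n - 1 - ((pos k).1 : ℕ)) (by omega)).charpoly) :
    (IsPBCompanion A ∧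
      ∀ b e : ℕ, (hbe : b ≤ e) → (he : e ≤ n) →
        (p ⟨e, by omega⟩).degree = (e : WithBot ℕ) →
        (∀ t : ℕ, (ht1 : b ≤ t) → (ht2 : t < e) →
          (p ⟨t, by omega⟩).degree ≠ (t : WithBot ℕ)) →
        (b = 0 ∨ (p ⟨b - 1, by omega⟩).degree = ((b - 1 : ℕ) : WithBot ℕ)) →
        e ≤ b + 1) ↔
    (∀ k : ℕ, (hkn : k < n) →
      ((∀ l : Fin n, (((pos l).1 : ℕ) = ((pos l).2 : ℕ) + k ↔ (l : ℕ) = k)) ∨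
      (∃ hk1 : k + 1 < n,
        (∀ l : Fin n,
          (((pos l).1 : ℕ) = ((pos l).2 : ℕ) + k ↔ ((l : ℕ) = k ∨ (l : ℕ) = k + 1))) ∧
        (∑ t : Fin n, if ((pos ⟨k, hkn⟩).1 : ℕ) - k ≤ (t : ℕ) ∧
            (t : ℕ) ≤ ((pos ⟨k, hkn⟩).1 : ℕ) then A t t else 0) ≠
        (∑ t : Fin n, if ((pos ⟨k + 1, hk1⟩).1 : ℕ) - k ≤ (t : ℕ) ∧
            (t : ℕ) ≤ ((pos ⟨k + 1, hk1⟩).1 : ℕ) then A t t else 0)) ∨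
      (∀ l : Fin n, ((pos l).1 : ℕ) ≠ ((pos l).2 : ℕ) + k))) := by
  set M := constPart A with hM
  let P : ℕ → F[X] := fun t => if h : t < n + 1 then p ⟨t, h⟩ else 0
  have hP : ∀ t (h : t < n + 1), P t = p ⟨t, h⟩ := fun t h => dif_pos h
  have hPn : P n = M.charpoly := by rw [hP n n.lt_succ_self, hpn]
  have hPk : ∀ k : Fin n, P (n - 1 - k) =
      (leadSub M ((pos k).2 : ℕ) ((pos k).2).isLt.le).charpoly *
      (trailSub M (n - 1 - ((pos k).1 : ℕ)) (by omega)).charpoly := fun k => by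
    rw [hP (n - 1 - k) (by omega), hpk k]
  have hindex : ∀ t < n, ∃ k : Fin n, t = n - 1 - k := fun t ht => ⟨⟨n - 1 - t, by omega⟩, by
    simp only
    omega⟩
  have hmonic : ∀ t ≤ n, (P t).Monic := by
    intro t ht
    rcases eq_or_lt_of_le ht with rfl | ht
    · rw [hPn]
      exact charpoly_monic _
    · obtain ⟨k, rfl⟩ := hindex t ht
      rw [hPk]
      exact monic_lead_mul_trail M _ _
  have hdegn : (P n).natDegree = n := by
    rw [hPn, charpoly_natDegree_eq_dim, Fintype.card_fin]
  have hdegk : ∀ k : Fin n, (P (n - 1 - k)).natDegree = n - 1 - ((pos k).1 - (pos k).2) := by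
    intro k
    have := hpos.1.1 k
    rw [hPk, natDegree_lead_mul_trail]
    omega
  have hmono : ∀ s t, s ≤ t → t ≤ n → (P s).natDegree ≤ (P t).natDegree := by
    intro s t hst ht
    rcases eq_or_lt_of_le ht with rfl | ht
    · rcases eq_or_lt_of_le hst with rfl | hst
      · exact le_rfl
      · obtain ⟨k, rfl⟩ := hindex s hst
        rw [hdegn, hdegk]
        omega
    · obtain ⟨k, hk⟩ := hindex s (by omega)
      obtain ⟨l, hl⟩ := hindex t ht
      have hlk : l ≤ k := by
        rw [Fin.le_def]
        omega
      have := hpos.1.sub_mono hlk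
      rw [hk, hl, hdegk, hdegk]
      omega
  have hgood : ∀ t (h : t < n + 1), (p ⟨t, h⟩).degree = (t : WithBot ℕ) ↔
      (P t).natDegree = t := by
    intro t h
    rw [← hP t h]
    exact monic_degree_eq_iff (hmonic t (by omega)) t
  have hmem : ∀ i, p i ∈ degreeLT F (n + 1) := by
    intro i
    have h1 := hmono i n (by omega) le_rfl
    rw [hP i i.2, hdegn] at h1
    exact mem_degreeLT_of_natDegree_lt (Nat.lt_succ_of_le h1)
  have hshort := blocks_short_iff (n := n) (fun t => (P t).natDegree = t) hdegn
  have hmain := linearIndependent_and_short_iff P hmonic hmono hdegn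
  have hpP : (fun i : Fin (n + 1) => P i) = p := funext fun i => hP i i.2
  rw [hpP] at hmain
  let d : ℕ → ℕ := fun l => if h : l < n then (pos ⟨l, h⟩).1 - (pos ⟨l, h⟩).2 else 0
  have hd : ∀ l (h : l < n), d l = (pos ⟨l, h⟩).1 - (pos ⟨l, h⟩).2 := fun l h => dif_pos h
  let σ : ℕ → F := fun l => if h : l < n then ∑ t : Fin n,
    if ((pos ⟨l, h⟩).2 : ℕ) ≤ (t : ℕ) ∧ (t : ℕ) ≤ ((pos ⟨l, h⟩).1 : ℕ) then M t t else 0 else 0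
  have hσ : ∀ l (h : l < n), σ l = ∑ t : Fin n,
      if ((pos ⟨l, h⟩).2 : ℕ) ≤ (t : ℕ) ∧ (t : ℕ) ≤ ((pos ⟨l, h⟩).1 : ℕ) then M t t else 0 :=
    fun l h => dif_pos h
  have hdlt : ∀ l < n, d l < n := by
    intro l hl
    rw [hd l hl]
    omega
  have hdegd : ∀ l < n, (P (n - 1 - l)).natDegree = n - 1 - d l := by
    intro l hl
    rw [hd l hl]
    exact hdegk ⟨l, hl⟩
  have hcoeff : ∀ l < n, ∀ m, n - 1 - d l = m + 1 →
      (P (n - 1 - l)).coeff m = σ l - M.trace := by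
    intro l hl m hm
    have := hpos.1.1 ⟨l, hl⟩
    rw [hd l hl] at hm
    rw [hPk ⟨l, hl⟩, coeff_lead_mul_trail M (hpos.1.1 ⟨l, hl⟩) (pos ⟨l, hl⟩).1.isLt (by omega), hσ]
  have hlocal : (∀ t < n, (P t).natDegree = t ∨ ((P t).natDegree = t + 1 ∧
      (P (t + 1)).natDegree = t + 1 ∧ (P (t + 1)).coeff t ≠ (P t).coeff t)) ↔
      ∀ l < n, d l = l ∨ ∃ k, l = k + 1 ∧ d l = k ∧ d k = k ∧ σ k ≠ σ l := by
    have hstep : ∀ l < n, ((P (n - 1 - l)).natDegree = n - 1 - l ∨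
        ((P (n - 1 - l)).natDegree = n - 1 - l + 1 ∧
        (P (n - 1 - l + 1)).natDegree = n - 1 - l + 1 ∧
        (P (n - 1 - l + 1)).coeff (n - 1 - l) ≠ (P (n - 1 - l)).coeff (n - 1 - l))) ↔
        (d l = l ∨ ∃ k, l = k + 1 ∧ d l = k ∧ d k = k ∧ σ k ≠ σ l) := by
      intro l hl
      have hdl := hdlt l hl
      refine or_congr (by rw [hdegd l hl]; omega) ?_
      rcases l with _ | k
      · refine iff_of_false ?_ ?_
        · rw [hdegd 0 hl]
          omega
        · rintro ⟨k, hk, -⟩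
          omega
      have hkn : k < n := by omega
      have hdk := hdlt k hkn
      have hidx : n - 1 - (k + 1) + 1 = n - 1 - k := by omega
      rw [hidx, hdegd k hkn, hdegd _ hl]
      have hex : (∃ k', k + 1 = k' + 1 ∧ d (k + 1) = k' ∧ d k' = k' ∧ σ k' ≠ σ (k + 1)) ↔
          d (k + 1) = k ∧ d k = k ∧ σ k ≠ σ (k + 1) :=
        ⟨by rintro ⟨k', hk', h⟩; obtain rfl : k = k' := by omega
            exact h, fun h => ⟨k, rfl, h⟩⟩
      rw [hex]
      have hne : d (k + 1) = k → d k = k →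
          ((P (n - 1 - k)).coeff (n - 1 - (k + 1)) ≠ (P (n - 1 - (k + 1))).coeff (n - 1 - (k + 1)) ↔
            σ k ≠ σ (k + 1)) := by
        intro h1 h2
        rw [hcoeff k hkn _ (by rw [h2, hidx]), hcoeff (k + 1) hl _ (by rw [h1, hidx]), ne_eq,
          sub_left_inj]
      have hcancel : ∀ x < n, n - 1 - x = n - 1 - k ↔ x = k := by
        intro x hx
        clear * - hx hkn
        omega
      rw [hcancel _ hdl, hcancel _ hdk]
      exact and_congr_right fun h1 => and_congr_right fun h2 => hne h1 h2
    constructor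
    · intro H l hl
      exact (hstep l hl).1 (H _ (by omega))
    · intro H t ht
      have := (hstep (n - 1 - t) (by omega)).2 (H _ (by omega))
      rwa [show n - 1 - (n - 1 - t) = t by omega] at this
  rw [hA.isPBCompanion_iff hpos p hpn hpk hmem]
  simp only [hgood, ne_eq]
  rw [hshort, hmain, hlocal, subdiagonal_conditions_iff d hdlt fun k l => σ k ≠ σ l]
  have hsub : ∀ l : Fin n, ∀ k, ((pos l).1 : ℕ) = (pos l).2 + k ↔ d l = k := by
    intro l k
    have := hpos.1.1 l
    have hdl : d l = (pos l).1 - (pos l).2 := hd l l.2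
    omega
  simp only [hsub, Fin.forall_iff]
  refine forall_congr' fun k => forall_congr' fun hk => or_congr Iff.rfl (or_congr ?_ Iff.rfl)
  rw [← exists_prop]
  refine exists_congr fun hk1 => and_congr_right fun hiff => ?_
  have e1 : ((pos ⟨k, hk⟩).1 : ℕ) - k = (pos ⟨k, hk⟩).2 := by
    have := (hsub ⟨k, hk⟩ k).2 ((hiff k hk).2 (Or.inl rfl))
    omega
  have e2 : ((pos ⟨k + 1, hk1⟩).1 : ℕ) - k = (pos ⟨k + 1, hk1⟩).2 := by
    have := (hsub ⟨k + 1, hk1⟩ k).2 ((hiff (k + 1) hk1).2 (Or.inr rfl))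
    omega
  rw [e1, e2, hσ k hk, hσ (k + 1) hk1]
  exact (hA.diag_sum_ne_iff hpos _ _).symm
end
end
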